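/- Let d ≥ 1 and d+2 ≥ q > p > 1. Then there exists a constant N = N(d, p, q) such that for every measurable vector field b on ℝ^{d+1} with ‖ |b| ‖_{E_{q,1}} < ∞ and every u ∈ C_0^∞(ℝ^{d+1}), one has ∫_{ℝ^{d+1}} |b|^p |Du|^p dz ≤ N ‖ |b| ‖_{E_{q,1}}^p ( ‖∂_t u‖_{L_p(ℝ^{d+1})}^p + ‖ |D²u| ‖_{L_p(ℝ^{d+1})}^p ). -/

import Mathlib

open MeasureTheory Set ENNReal Filter

noncomputable section

/-- Euclidean space `ℝ^d`. -/
abbrev Ed (d : ℕ) := EuclideanSpace ℝ (Fin d)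

/-- Points of `ℝ^{d+1}`: `z = (t, x)`. -/
abbrev Pt (d : ℕ) := ℝ × Ed d

/-- The parabolic cylinder `C_ρ(t,x)`. -/
def pCyl (d : ℕ) (ρ : ℝ) (z : Pt d) : Set (Pt d) :=
  {w | dist z.2 w.2 < ρ ∧ z.1 ≤ w.1 ∧ w.1 < z.1 + ρ ^ 2}

/-- The average `⨍_{C_ρ(z)} f`. -/
def pAvg (d : ℕ) (ρ : ℝ) (z : Pt d) (f : Pt d → ℝ≥0∞) : ℝ≥0∞ :=
  (volume (pCyl d ρ z))⁻¹ * ∫⁻ w in pCyl d ρ z, f w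

/-- The fractional maximal function `M_β f`. -/
def Mbeta (d : ℕ) (β : ℝ) (f : Pt d → ℝ≥0∞) (z : Pt d) : ℝ≥0∞ :=
  ⨆ (ρ : ℝ) (_ : 0 < ρ), ENNReal.ofReal (ρ ^ β) * pAvg d ρ z f

/-- The kernel `p_α(s, r)`. -/
def pKer (d : ℕ) (α : ℝ) (s r : ℝ) : ℝ≥0∞ :=
  if 0 < s then ENNReal.ofReal (s ^ (-(((d : ℝ) + 2 - α) / 2)) * Real.exp (-(r ^ 2) / s)) else 0

/-- The parabolic potential `P_α f`. -/
def Palpha (d : ℕ) (α : ℝ) (f : Pt d → ℝ≥0∞) (z : Pt d) : ℝ≥0∞ :=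
  ∫⁻ w : Pt d, pKer d α w.1 ‖w.2‖ * f (z.1 + w.1, z.2 + w.2)

/-- The parabolic Morrey norm `‖f‖_{E_{p,β}(Q)}`. -/
def MorreyNorm (d : ℕ) (p β : ℝ) (Q : Set (Pt d)) (f : Pt d → ℝ≥0∞) : ℝ≥0∞ :=
  ⨆ (ρ : ℝ) (_ : 0 < ρ) (z : Pt d) (_ : z ∈ Q),
    ENNReal.ofReal (ρ ^ β) * (pAvg d ρ z fun w => Q.indicator f w ^ p) ^ (1 / p)

/-- The `L_p`-norm on `ℝ^{d+1}`. -/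
def LpNormE (d : ℕ) (p : ℝ) (f : Pt d → ℝ≥0∞) : ℝ≥0∞ :=
  (∫⁻ z : Pt d, f z ^ p) ^ (1 / p)

/-- The mixed norm `‖f‖_{L_{q₁,q₂}}`. -/
def MixedNorm (d : ℕ) (q₁ q₂ : ℝ) (f : Pt d → ℝ≥0∞) : ℝ≥0∞ :=
  (∫⁻ t : ℝ, (∫⁻ x : Ed d, f (t, x) ^ q₁) ^ (q₂ / q₁)) ^ (1 / q₂)

/-- The normalized mixed norm `‖f‖_{L_{q₁,q₂}(Γ)}`. -/
def MixedNormOn (d : ℕ) (q₁ q₂ : ℝ) (Γ : Set (Pt d)) (f : Pt d → ℝ≥0∞) : ℝ≥0∞ :=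
  (MixedNorm d q₁ q₂ (Γ.indicator 1))⁻¹ * MixedNorm d q₁ q₂ (Γ.indicator f)

/-- The mixed-norm parabolic Morrey norm `‖f‖_{E_{q₁,q₂,β}(Q)}`. -/
def MixedMorrey (d : ℕ) (q₁ q₂ β : ℝ) (Q : Set (Pt d)) (f : Pt d → ℝ≥0∞) : ℝ≥0∞ :=
  ⨆ (ρ : ℝ) (_ : 0 < ρ) (z : Pt d) (_ : z ∈ Q),
    ENNReal.ofReal (ρ ^ β) * MixedNormOn d q₁ q₂ (pCyl d ρ z) (Q.indicator f)

/-- The symmetric parabolic maximal function `M̂ f`. -/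
def pMax (d : ℕ) (f : Pt d → ℝ≥0∞) (z : Pt d) : ℝ≥0∞ :=
  ⨆ (r : ℝ) (_ : 0 < r) (w : Pt d) (_ : z ∈ pCyl d r w), pAvg d r w f

/-- The time derivative `∂_t u`. -/
def timeDeriv (d : ℕ) (u : Pt d → ℝ) (z : Pt d) : ℝ :=
  fderiv ℝ u z ((1 : ℝ), (0 : Ed d))

/-- The spatial partial derivative `D_i u`. -/
def spDeriv (d : ℕ) (i : Fin d) (u : Pt d → ℝ) (z : Pt d) : ℝ :=
  fderiv ℝ u z ((0 : ℝ), EuclideanSpace.single i (1 : ℝ))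

/-- The Euclidean norm of the spatial gradient `|Du|`. -/
def gradNorm (d : ℕ) (u : Pt d → ℝ) (z : Pt d) : ℝ :=
  Real.sqrt (∑ i : Fin d, spDeriv d i u z ^ 2)

/-- The spatial Laplacian `Δu`. -/
def lap (d : ℕ) (u : Pt d → ℝ) (z : Pt d) : ℝ :=
  ∑ i : Fin d, spDeriv d i (spDeriv d i u) z

/-- The (Frobenius) norm of the spatial Hessian `|D²u|`. -/
def hessNorm (d : ℕ) (u : Pt d → ℝ) (z : Pt d) : ℝ :=
  Real.sqrt (∑ i : Fin d, ∑ j : Fin d, spDeriv d i (spDeriv d j u) z ^ 2)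

set_option linter.unusedSectionVars false



lemma le_inv_mul_of' {a x y : ℝ≥0∞} (h0 : a ≠ 0) (ht : a ≠ ⊤) (h : a * x ≤ y) : x ≤ a⁻¹ * y := by
  calc x = a⁻¹ * (a * x) := by rw [← mul_assoc, ENNReal.inv_mul_cancel h0 ht, one_mul]
    _ ≤ _ := by gcongr

/-- A dyadic system of quasi-balls. -/
structure QSys {X : Type} [TopologicalSpace X] [MeasurableSpace X] (μ : Measure X) where
  Q : ℤ → X → Set X
  V : ℤ → ℝ≥0∞
  D : ℝ≥0∞
  D_top : D ≠ ⊤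
  D_one : 1 ≤ D
  V_zero : ∀ k, V k ≠ 0
  V_top : ∀ k, V k ≠ ⊤
  V_succ : ∀ k, V (k + 1) = D * V k
  meas : ∀ k z, μ (Q k z) = V k
  isOpen : ∀ k, IsOpen {p : X × X | p.2 ∈ Q k p.1}
  symm : ∀ k z w, w ∈ Q k z → z ∈ Q k w
  self : ∀ k z, z ∈ Q k z
  mono : ∀ k l z, k ≤ l → Q k z ⊆ Q l z
  trans : ∀ k z w v, w ∈ Q k z → v ∈ Q k w → v ∈ Q (k + 1) z
  cover : ∀ z w, ∃ n : ℕ, w ∈ Q (n : ℤ) z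

namespace QSys
variable {X : Type} [TopologicalSpace X] [MeasurableSpace X] [BorelSpace X]
  [SecondCountableTopology X] {μ : Measure X} [SFinite μ] (S : QSys μ)

lemma isOpen_Q (k : ℤ) (z : X) : IsOpen (S.Q k z) :=
  (S.isOpen k).preimage (f := fun w => (z, w)) (by fun_prop)

lemma measurableSet_Q (k : ℤ) (z : X) : MeasurableSet (S.Q k z) := (S.isOpen_Q k z).measurableSet

/-- Averages. -/
def A (g : X → ℝ≥0∞) (k : ℤ) (z : X) : ℝ≥0∞ := (S.V k)⁻¹ * ∫⁻ w in S.Q k z, g w ∂μ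

/-- maximal function -/
def M (g : X → ℝ≥0∞) (z : X) : ℝ≥0∞ := ⨆ k, S.A g k z

lemma lint_eq (g : X → ℝ≥0∞) (k : ℤ) (z : X) : ∫⁻ w in S.Q k z, g w ∂μ = S.V k * S.A g k z := by
  rw [A, ← mul_assoc, ENNReal.mul_inv_cancel (S.V_zero k) (S.V_top k), one_mul]

lemma meas_int {g : X → ℝ≥0∞} (hg : Measurable g) (k : ℤ) :
    Measurable fun z => ∫⁻ w in S.Q k z, g w ∂μ := by
  have : (fun z => ∫⁻ w in S.Q k z, g w ∂μ) =
      fun z => ∫⁻ w, ({p : X × X | p.2 ∈ S.Q k p.1}.indicator (fun p => g p.2)) (z, w) ∂μ := by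
    ext z
    rw [← lintegral_indicator (S.measurableSet_Q k z)]
    rfl
  rw [this]
  apply Measurable.lintegral_prod_right'
  exact (hg.comp measurable_snd).indicator (S.isOpen k).measurableSet

lemma meas_A {g : X → ℝ≥0∞} (hg : Measurable g) (k : ℤ) : Measurable (S.A g k) :=
  (S.meas_int hg k).const_mul _

lemma meas_M {g : X → ℝ≥0∞} (hg : Measurable g) : Measurable (S.M g) :=
  Measurable.iSup fun k => S.meas_A hg k

lemma weak (g : X → ℝ≥0∞) (lam : ℝ≥0∞) (h0 : lam ≠ 0) (ht : lam ≠ ⊤) (k : ℤ) (z : X) :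
    μ {w | w ∈ S.Q k z ∧ ∃ j ≤ k, lam < S.A g j w} ≤
      S.D * lam⁻¹ * ∫⁻ w in S.Q (k + 1) z, g w ∂μ := by
  set t : Set (ℤ × X) := {a | a.1 ≤ k ∧ a.2 ∈ S.Q k z ∧ lam < S.A g a.1 a.2} with htdef
  obtain ⟨u, hut, hdis, hcov⟩ := Vitali.exists_disjoint_subfamily_covering_enlargement
    (fun a : ℤ × X => S.Q a.1 a.2) t (fun a => (2:ℝ) ^ a.1) (3/2) (by norm_num)
    (fun a _ => by positivity) ((2:ℝ) ^ k)
    (fun a ha => zpow_le_zpow_right₀ (by norm_num) ha.1)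
    (fun a _ => ⟨a.2, S.self _ _⟩)
  have hcount : u.Countable := hdis.countable_of_isOpen (fun a _ => S.isOpen_Q _ _)
    (fun a _ => ⟨a.2, S.self _ _⟩)
  have hsub : {w | w ∈ S.Q k z ∧ ∃ j ≤ k, lam < S.A g j w} ⊆ ⋃ a ∈ u, S.Q (a.1 + 1) a.2 := by
    rintro w ⟨hw, j, hj, hl⟩
    obtain ⟨b, hb, ⟨v, hv1, hv2⟩, hle⟩ := hcov (j, w) ⟨hj, hw, hl⟩
    have hjb : j ≤ b.1 := by
      by_contra! hlt
      have h1 : (2:ℝ) ^ (b.1 + 1) ≤ 2 ^ j := zpow_le_zpow_right₀ (by norm_num) (by omega)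
      rw [zpow_add_one₀ (by norm_num)] at h1
      have h2 : (0:ℝ) < 2 ^ b.1 := by positivity
      simp only at hle
      linarith
    simp only [mem_iUnion]
    exact ⟨b, hb, S.trans _ _ _ _ hv2 (S.mono _ _ _ hjb (S.symm _ _ _ hv1))⟩
  calc _ ≤ μ (⋃ a ∈ u, S.Q (a.1 + 1) a.2) := measure_mono hsub
    _ ≤ ∑' a : u, μ (S.Q (a.1.1 + 1) a.1.2) := measure_biUnion_le μ hcount _
    _ ≤ ∑' a : u, S.D * lam⁻¹ * ∫⁻ w in S.Q a.1.1 a.1.2, g w ∂μ := by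
        refine ENNReal.tsum_le_tsum fun a => ?_
        rw [S.meas, S.V_succ, mul_assoc]
        gcongr
        have h3 := (hut a.2).2.2
        rw [S.lint_eq]
        refine le_inv_mul_of' h0 ht ?_
        rw [mul_comm]
        gcongr
    _ = S.D * lam⁻¹ * ∫⁻ w in ⋃ a ∈ u, S.Q a.1 a.2, g w ∂μ := by
        rw [lintegral_biUnion hcount (fun a _ => S.measurableSet_Q _ _) hdis, ENNReal.tsum_mul_left]
    _ ≤ _ := by
        gcongr
        refine iUnion₂_subset fun a ha w hw => ?_
        exact S.trans _ _ _ _ (hut ha).2.1 (S.mono _ _ _ (hut ha).1 hw)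

/-- pointwise dyadic decomposition -/
lemma pow_le_sum (h s : ℝ≥0∞) (hs0 : s ≠ 0) (hst : s ≠ ⊤) (θ : ℝ) (hθ : 0 < θ) :
    h ^ θ ≤ s ^ θ + ∑' m : ℕ, (2 ^ (m + 1) * s) ^ θ * (if 2 ^ m * s < h then 1 else 0) := by
  rcases le_or_gt h s with hh | hh
  · exact le_trans (ENNReal.rpow_le_rpow hh hθ.le) le_self_add
  by_cases ht : h = ⊤
  · have : ∑' m : ℕ, (2 ^ (m + 1) * s) ^ θ * (if 2 ^ m * s < h then 1 else 0) = ⊤ := by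
      rw [eq_top_iff]
      calc ⊤ = ∑' m : ℕ, s ^ θ := by
            rw [ENNReal.tsum_const_eq_top_of_ne_zero]
            simp [hs0, hst]
        _ ≤ _ := by
          refine ENNReal.tsum_le_tsum fun m => ?_
          rw [if_pos (by rw [ht]; exact (ENNReal.mul_ne_top (by simp) hst).lt_top), mul_one]
          gcongr
          exact le_mul_of_one_le_left' (one_le_pow₀ (by norm_num))
    rw [this]; simp
  · have hx : ∃ m : ℕ, h ≤ 2 ^ (m + 1) * s := by
      obtain ⟨m, hm⟩ := ENNReal.exists_nat_gt (ENNReal.div_ne_top ht hs0)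
      refine ⟨m, ?_⟩
      rw [← ENNReal.div_le_iff hs0 hst]
      refine hm.le.trans ?_
      have : m ≤ 2 ^ (m + 1) := (Nat.lt_two_pow_self).le.trans (Nat.pow_le_pow_right (by norm_num) (by omega))
      exact_mod_cast this
    classical
    have hm := Nat.find_spec hx
    set m := Nat.find hx with hmdef
    have hlt : 2 ^ m * s < h := by
      by_cases h0 : m = 0
      · rw [h0]; simpa using hh
      · have := Nat.find_min hx (m := m - 1) (by omega)
        rw [not_le, Nat.sub_add_cancel (by omega)] at this
        exact this
    calc h ^ θ ≤ (2 ^ (m + 1) * s) ^ θ * (if 2 ^ m * s < h then 1 else 0) := by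
          rw [if_pos hlt, mul_one]; gcongr
      _ ≤ _ := (ENNReal.le_tsum m).trans le_add_self

/-- Kolmogorov constant -/
def KC (θ : ℝ) : ℝ≥0∞ := S.D ^ θ * (1 + ∑' m : ℕ, (2 ^ (m + 1)) ^ θ * ((2 * S.D) * (2 ^ m)⁻¹))

lemma KC_top (θ : ℝ) (h0 : 0 < θ) (h1 : θ < 1) : S.KC θ ≠ ⊤ := by
  apply ENNReal.mul_ne_top (ENNReal.rpow_ne_top_of_nonneg h0.le S.D_top)
  refine ENNReal.add_ne_top.2 ⟨by simp, ?_⟩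
  have : ∀ m : ℕ, ((2:ℝ≥0∞) ^ (m + 1)) ^ θ * ((2 * S.D) * (2 ^ m)⁻¹) =
      (2 ^ θ * (2 * S.D)) * (2 ^ (θ - 1)) ^ m := by
    intro m
    rw [ENNReal.rpow_sub _ _ (by norm_num) (by norm_num), ENNReal.rpow_one, pow_succ,
      ENNReal.mul_rpow_of_nonneg _ _ h0.le, ENNReal.div_eq_inv_mul, mul_pow, ENNReal.inv_pow,
      ← ENNReal.rpow_natCast, ← ENNReal.rpow_natCast (2 ^ θ), ← ENNReal.rpow_mul, ← ENNReal.rpow_mul,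
      mul_comm θ]
    ring
  simp_rw [this, ENNReal.tsum_mul_left, ENNReal.tsum_geometric]
  refine ENNReal.mul_ne_top (ENNReal.mul_ne_top (ENNReal.rpow_ne_top_of_nonneg h0.le (by simp))
    (ENNReal.mul_ne_top (by simp) S.D_top)) ?_
  rw [Ne, ENNReal.inv_eq_top, tsub_eq_zero_iff_le, not_le]
  exact ENNReal.rpow_lt_one_of_one_lt_of_neg (by norm_num) (by linarith)

lemma kolm {g : X → ℝ≥0∞} (hg : Measurable g) (θ : ℝ) (hθ : 0 < θ) (A0 : ℝ≥0∞)
    (h0 : A0 ≠ 0) (ht : A0 ≠ ⊤) (k : ℤ) (z : X) (hA : ∀ l ≥ k, S.A g l z ≤ A0) :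
    ∫⁻ w in S.Q k z, (g w ⊔ S.M g w) ^ θ ∂μ ≤ S.KC θ * A0 ^ θ * S.V k := by
  have hD0 : S.D ≠ 0 := (lt_of_lt_of_le one_pos S.D_one).ne'
  set s := S.D * A0 with hs
  have hs0 : s ≠ 0 := mul_ne_zero hD0 h0
  have hst : s ≠ ⊤ := ENNReal.mul_ne_top S.D_top ht
  have hmh : Measurable fun w => g w ⊔ S.M g w := hg.sup (S.meas_M hg)
  have key : ∀ m : ℕ, μ {w | w ∈ S.Q k z ∧ 2 ^ m * s < g w ⊔ S.M g w} ≤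
      (2 * S.D) * (2 ^ m)⁻¹ * S.V k := by
    intro m
    set lam := 2 ^ m * s with hlam
    have hl0 : lam ≠ 0 := mul_ne_zero (by simp) hs0
    have hlt : lam ≠ ⊤ := ENNReal.mul_ne_top (by simp) hst
    have hsl : s ≤ lam := le_mul_of_one_le_left' (one_le_pow₀ (by norm_num))
    have hsub : {w | w ∈ S.Q k z ∧ lam < g w ⊔ S.M g w} ⊆
        {w | w ∈ S.Q k z ∧ lam ≤ g w} ∪ {w | w ∈ S.Q k z ∧ ∃ j ≤ k, lam < S.A g j w} := by
      rintro w ⟨hw, hlt'⟩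
      rcases lt_sup_iff.1 hlt' with h | h
      · exact Or.inl ⟨hw, h.le⟩
      · right
        obtain ⟨j, hj⟩ := lt_iSup_iff.1 h
        refine ⟨hw, j, ?_, hj⟩
        by_contra! hkj
        refine absurd hj (not_lt.2 (le_trans ?_ hsl))
        have h1 : ∫⁻ v in S.Q j w, g v ∂μ ≤ ∫⁻ v in S.Q (j + 1) z, g v ∂μ :=
          lintegral_mono_set fun v hv => S.trans _ _ _ _ (S.mono _ _ _ hkj.le hw) hv
        rw [S.lint_eq, S.lint_eq, S.V_succ] at h1
        have h2 : S.V j * S.A g j w ≤ S.V j * s := by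
          refine h1.trans ?_
          rw [hs, mul_comm S.D, mul_assoc]
          gcongr
          exact hA _ (by omega)
        exact (ENNReal.mul_le_mul_iff_right (S.V_zero j) (S.V_top j)).1 h2
    have hw1 : μ {w | w ∈ S.Q k z ∧ lam ≤ g w} ≤ lam⁻¹ * ∫⁻ w in S.Q k z, g w ∂μ := by
      refine le_inv_mul_of' hl0 hlt ?_
      have := mul_meas_ge_le_lintegral₀ (μ := μ.restrict (S.Q k z)) hg.aemeasurable lam
      rw [Measure.restrict_apply (measurableSet_le measurable_const hg)] at this
      convert this using 3
      ext w; simp [and_comm]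
    have hcomp : ∀ a : ℝ≥0∞, lam⁻¹ * (S.D * S.V k * A0) = (2 ^ m)⁻¹ * S.V k := by
      intro _
      rw [hlam, hs, ENNReal.mul_inv (by simp) (by simp),
        ENNReal.mul_inv (Or.inl hD0) (Or.inl S.D_top)]
      calc _ = (S.D⁻¹ * S.D) * (A0⁻¹ * A0) * ((2 ^ m)⁻¹ * S.V k) := by ring
        _ = _ := by rw [ENNReal.inv_mul_cancel hD0 S.D_top, ENNReal.inv_mul_cancel h0 ht]; simp
    calc _ ≤ lam⁻¹ * (∫⁻ w in S.Q k z, g w ∂μ) + S.D * lam⁻¹ * ∫⁻ w in S.Q (k + 1) z, g w ∂μ :=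
          (measure_mono hsub).trans ((measure_union_le _ _).trans
            (add_le_add hw1 (S.weak g lam hl0 hlt k z)))
      _ ≤ S.D * (lam⁻¹ * (S.D * S.V k * A0)) + S.D * (lam⁻¹ * (S.D * S.V k * A0)) := by
          rw [S.lint_eq, S.lint_eq, mul_assoc S.D, S.V_succ]
          refine add_le_add ?_ ?_
          · calc lam⁻¹ * (S.V k * S.A g k z) ≤ lam⁻¹ * (S.D * S.V k * A0) := by
                  gcongr
                  · exact le_mul_of_one_le_left' S.D_one
                  · exact hA _ le_rfl
              _ ≤ _ := le_mul_of_one_le_left' S.D_one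
          · gcongr
            exact hA _ (by omega)
      _ = _ := by rw [hcomp 0]; ring
  calc ∫⁻ w in S.Q k z, (g w ⊔ S.M g w) ^ θ ∂μ
      ≤ ∫⁻ w in S.Q k z, (s ^ θ + ∑' m : ℕ, (2 ^ (m + 1) * s) ^ θ *
          ({w | 2 ^ m * s < g w ⊔ S.M g w}.indicator 1 w)) ∂μ := by
        refine lintegral_mono fun w => ?_
        refine (pow_le_sum _ s hs0 hst θ hθ).trans (le_of_eq ?_)
        congr 2
        ext m
        simp only [indicator_apply, mem_ofPred_eq, Pi.one_apply]
    _ = s ^ θ * S.V k + ∑' m : ℕ, (2 ^ (m + 1) * s) ^ θ *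
          μ {w | w ∈ S.Q k z ∧ 2 ^ m * s < g w ⊔ S.M g w} := by
        have hms : ∀ m : ℕ, MeasurableSet {w | 2 ^ m * s < g w ⊔ S.M g w} := fun m =>
          measurableSet_lt measurable_const hmh
        rw [lintegral_add_left measurable_const, lintegral_const, Measure.restrict_apply_univ,
          S.meas, lintegral_tsum]
        · congr 2
          ext m
          rw [lintegral_const_mul _ (measurable_one.indicator (hms m)), lintegral_indicator_one (hms m),
            Measure.restrict_apply (hms m)]
          congr 2
          ext w; simp [and_comm]
        · intro m
          exact ((measurable_one.indicator (hms m)).const_mul _).aemeasurable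
    _ ≤ s ^ θ * S.V k + ∑' m : ℕ, (2 ^ (m + 1) * s) ^ θ * ((2 * S.D) * (2 ^ m)⁻¹ * S.V k) := by
        gcongr with m
        exact key m
    _ = _ := by
        simp_rw [ENNReal.mul_rpow_of_nonneg _ s hθ.le]
        rw [KC, hs, ENNReal.mul_rpow_of_nonneg _ _ hθ.le, mul_add, add_mul, add_mul, mul_one,
          ← ENNReal.tsum_mul_left, ← ENNReal.tsum_mul_right, ← ENNReal.tsum_mul_right]
        congr 2
        ext m
        ring
end QSys



/-- geometric constant -/
def SC (γ : ℝ) : ℝ≥0∞ := ∑' j : ℤ, (2:ℝ≥0∞) ^ j * (min 1 (2 * (2 ^ j)⁻¹)) ^ γ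

lemma SC_top (γ : ℝ) (hγ : 1 < γ) : SC γ ≠ ⊤ := by
  rw [SC, tsum_of_nat_of_neg_add_one ENNReal.summable ENNReal.summable]
  refine ENNReal.add_ne_top.2 ⟨?_, ?_⟩
  · have h1 : ∀ n : ℕ, (2:ℝ≥0∞) ^ (n:ℤ) * (min 1 (2 * (2 ^ (n:ℤ))⁻¹)) ^ γ ≤
        2 ^ γ * (2 ^ (1 - γ)) ^ n := by
      intro n
      calc (2:ℝ≥0∞) ^ (n:ℤ) * (min 1 (2 * (2 ^ (n:ℤ))⁻¹)) ^ γ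
          ≤ (2:ℝ≥0∞) ^ (n:ℤ) * (2 * (2 ^ (n:ℤ))⁻¹) ^ γ := by
            gcongr
            exact min_le_right _ _
        _ = _ := by
          rw [zpow_natCast, ENNReal.mul_rpow_of_nonneg _ _ (by linarith),
            ENNReal.rpow_sub _ _ (by norm_num) (by norm_num), ENNReal.rpow_one,
            ENNReal.div_eq_inv_mul, mul_pow, ENNReal.inv_pow]
          have h5 : ((2⁻¹ : ℝ≥0∞) ^ n) ^ γ = (2 ^ γ)⁻¹ ^ n := by
            rw [← ENNReal.inv_rpow, ← ENNReal.rpow_natCast, ← ENNReal.rpow_natCast,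
              ← ENNReal.rpow_mul, ← ENNReal.rpow_mul, mul_comm]
          rw [h5]
          ring
    refine ne_top_of_le_ne_top ?_ (ENNReal.tsum_le_tsum h1)
    rw [ENNReal.tsum_mul_left, ENNReal.tsum_geometric]
    refine ENNReal.mul_ne_top (ENNReal.rpow_ne_top_of_nonneg (by linarith) (by simp)) ?_
    rw [Ne, ENNReal.inv_eq_top, tsub_eq_zero_iff_le, not_le]
    exact ENNReal.rpow_lt_one_of_one_lt_of_neg (by norm_num) (by linarith)
  · have h1 : ∀ n : ℕ, (2:ℝ≥0∞) ^ (-((n:ℤ) + 1)) * (min 1 (2 * (2 ^ (-((n:ℤ) + 1)))⁻¹)) ^ γ ≤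
        2⁻¹ * (2⁻¹) ^ n := by
      intro n
      calc _ ≤ (2:ℝ≥0∞) ^ (-((n:ℤ) + 1)) * 1 ^ γ := by
            gcongr
            exact min_le_left _ _
        _ = _ := by
          rw [ENNReal.one_rpow, mul_one, ENNReal.zpow_neg, ← pow_succ', ← ENNReal.inv_pow]
          norm_cast
    refine ne_top_of_le_ne_top ?_ (ENNReal.tsum_le_tsum h1)
    rw [ENNReal.tsum_mul_left, ENNReal.tsum_geometric]
    refine ENNReal.mul_ne_top (by simp) ?_
    simp

lemma sum_min_le (γ : ℝ) (hγ : 1 < γ) (β B : ℝ≥0∞) (h0 : β ≠ 0) (ht : β ≠ ⊤) (hB0 : B ≠ 0)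
    (hBt : B ≠ ⊤) :
    ∑' k : ℤ, (2:ℝ≥0∞) ^ k * (min β (B * (2 ^ k)⁻¹)) ^ γ ≤ SC γ * B * β ^ (γ - 1) := by
  obtain ⟨k0, hk1, hk2⟩ := ENNReal.exists_mem_Ico_zpow (x := B / β) (y := 2)
    (by simp [hB0, ht]) (ENNReal.div_ne_top hBt h0) (by norm_num) (by norm_num)
  rw [← (Equiv.addLeft k0).tsum_eq]
  have hc : B / β * β ^ γ = B * β ^ (γ - 1) := by
    rw [ENNReal.rpow_sub _ _ h0 ht, ENNReal.rpow_one, ENNReal.div_eq_inv_mul, ENNReal.div_eq_inv_mul]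
    ring
  rw [mul_assoc, ← hc, mul_comm, SC, ← ENNReal.tsum_mul_left]
  refine ENNReal.tsum_le_tsum fun j => ?_
  simp only [Equiv.coe_addLeft]
  rw [ENNReal.zpow_add (by norm_num) (by norm_num)]
  have hz0 : ∀ i : ℤ, (2:ℝ≥0∞) ^ i ≠ 0 := fun i => (ENNReal.zpow_pos (by norm_num) (by norm_num) i).ne'
  have hzt : ∀ i : ℤ, (2:ℝ≥0∞) ^ i ≠ ⊤ := fun i => (ENNReal.zpow_lt_top (by norm_num) (by norm_num) i).ne
  have hBle : B ≤ β * (2 ^ k0 * 2) := by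
    rw [ENNReal.zpow_add (by norm_num) (by norm_num), zpow_one] at hk2
    have := (ENNReal.div_le_iff h0 ht).1 hk2.le
    rwa [mul_comm] at this
  have hmin : min β (B * (2 ^ k0 * 2 ^ j)⁻¹) ≤ β * min 1 (2 * (2 ^ j)⁻¹) := by
    rw [mul_min, mul_one]
    refine min_le_min le_rfl ?_
    rw [ENNReal.mul_inv (Or.inl (hz0 _)) (Or.inl (hzt _))]
    calc B * ((2 ^ k0)⁻¹ * (2 ^ j)⁻¹) ≤ β * (2 ^ k0 * 2) * ((2 ^ k0)⁻¹ * (2 ^ j)⁻¹) := by gcongr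
      _ = ((2 ^ k0) * (2 ^ k0)⁻¹) * (β * (2 * (2 ^ j)⁻¹)) := by ring
      _ = _ := by rw [ENNReal.mul_inv_cancel (hz0 _) (hzt _), one_mul]
  calc 2 ^ k0 * 2 ^ j * min β (B * (2 ^ k0 * 2 ^ j)⁻¹) ^ γ
      ≤ (B / β) * 2 ^ j * (β * min 1 (2 * (2 ^ j)⁻¹)) ^ γ := by gcongr
    _ = _ := by
      rw [ENNReal.mul_rpow_of_nonneg _ _ (by linarith)]
      ring

namespace QSys
variable {X : Type} [TopologicalSpace X] [MeasurableSpace X] [BorelSpace X]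
  [SecondCountableTopology X] {μ : Measure X} [SFinite μ] (S : QSys μ)

/-- The discrete potential. -/
def T (f : X → ℝ≥0∞) (z : X) : ℝ≥0∞ := ∑' k : ℤ, (2:ℝ≥0∞) ^ k * S.A f k z

/-- The kernel of the potential. -/
def K (z w : X) : ℝ≥0∞ := ∑' k : ℤ, (2:ℝ≥0∞) ^ k * (S.V k)⁻¹ * (S.Q k z).indicator 1 w

lemma K_symm (z w : X) : S.K z w = S.K w z := by
  unfold K
  congr 1; ext k
  congr 1
  by_cases h : w ∈ S.Q k z
  · rw [indicator_of_mem h, indicator_of_mem (S.symm _ _ _ h)]; rfl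
  · rw [indicator_of_notMem h, indicator_of_notMem (fun h' => h (S.symm _ _ _ h'))]

lemma meas_K : Measurable (Function.uncurry S.K) := by
  unfold K
  refine Measurable.tsum fun k => ?_
  refine Measurable.const_mul ?_ _
  exact (measurable_one (α := ℝ≥0∞)).indicator (S.isOpen k).measurableSet

lemma meas_K_right (z : X) : Measurable (S.K z) := S.meas_K.comp measurable_prodMk_left

lemma T_eq {f : X → ℝ≥0∞} (hf : Measurable f) (z : X) : S.T f z = ∫⁻ w, S.K z w * f w ∂μ := by
  unfold T K
  simp_rw [← ENNReal.tsum_mul_right]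
  rw [lintegral_tsum]
  · congr 1; ext k
    rw [A, ← mul_assoc, ← lintegral_indicator (S.measurableSet_Q k z), ← lintegral_const_mul]
    · congr 1; ext w
      by_cases h : w ∈ S.Q k z
      · simp [indicator_of_mem h]
      · simp [indicator_of_notMem h]
    · exact hf.indicator (S.measurableSet_Q k z)
  · intro k
    refine (Measurable.mul (Measurable.const_mul ?_ _) hf).aemeasurable
    exact (measurable_one (α := ℝ≥0∞)).indicator (S.measurableSet_Q k z)

/-- The majorant of `b`. -/
def bt (q : ℝ) (b : X → ℝ≥0∞) (z : X) : ℝ≥0∞ :=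
  (b z ^ q ⊔ S.M (fun w => b w ^ q) z) ^ (1 / q)

lemma meas_bt (q : ℝ) {b : X → ℝ≥0∞} (hb : Measurable b) : Measurable (S.bt q b) :=
  ((hb.pow_const q).sup (S.meas_M (hb.pow_const q))).pow_const _

lemma le_bt (q : ℝ) (hq : 0 < q) (b : X → ℝ≥0∞) (z : X) : b z ≤ S.bt q b z := by
  calc b z = (b z ^ q) ^ (1 / q) := by
        rw [← ENNReal.rpow_mul, mul_one_div_cancel hq.ne', ENNReal.rpow_one]
    _ ≤ _ := by unfold bt; gcongr; exact le_sup_left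

lemma A_le_bt (q : ℝ) (hq : 0 < q) (b : X → ℝ≥0∞) (k : ℤ) (z : X) :
    S.A (fun w => b w ^ q) k z ≤ S.bt q b z ^ q := by
  rw [bt, ← ENNReal.rpow_mul, one_div_mul_cancel hq.ne', ENNReal.rpow_one]
  exact le_trans (le_iSup (fun k => S.A (fun w => b w ^ q) k z) k) le_sup_right

lemma zpow2_ne_zero (i : ℤ) : (2:ℝ≥0∞) ^ i ≠ 0 := (ENNReal.zpow_pos (by norm_num) (by norm_num) i).ne'
lemma zpow2_ne_top (i : ℤ) : (2:ℝ≥0∞) ^ i ≠ ⊤ := (ENNReal.zpow_lt_top (by norm_num) (by norm_num) i).ne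

lemma zpow_inv_anti {k l : ℤ} (h : k ≤ l) : ((2:ℝ≥0∞) ^ l)⁻¹ ≤ (2 ^ k)⁻¹ := by
  rw [ENNReal.inv_le_inv]
  exact ENNReal.zpow_le_of_le (by norm_num) h

lemma bt_int {q : ℝ} (hq : 0 < q) {b : X → ℝ≥0∞} (hb : Measurable b) {γ : ℝ} (hγ : 0 < γ)
    (k : ℤ) (z : X) (a : ℝ≥0∞) (ha0 : a ≠ 0) (hat : a ≠ ⊤)
    (hA : ∀ l ≥ k, S.A (fun w => b w ^ q) l z ≤ a ^ q) :
    S.A (fun w => S.bt q b w ^ γ) k z ≤ S.KC (γ / q) * a ^ γ := by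
  have h := S.kolm (hb.pow_const q) (γ / q) (by positivity) (a ^ q)
    (by simp [ha0, hq, hat]) (by simp [ha0, hq.le, hat]) k z hA
  rw [← ENNReal.rpow_mul, mul_div_cancel₀ _ hq.ne'] at h
  have h2 : S.V k * S.A (fun w => S.bt q b w ^ γ) k z ≤ S.V k * (S.KC (γ / q) * a ^ γ) := by
    rw [← S.lint_eq, mul_comm (S.V k)]
    refine le_trans (le_of_eq ?_) h
    congr 1
    ext w
    rw [bt, ← ENNReal.rpow_mul]
    congr 1
    ring
  exact (ENNReal.mul_le_mul_iff_right (S.V_zero k) (S.V_top k)).1 h2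

lemma T_bt_le {q : ℝ} {b : X → ℝ≥0∞} (hb : Measurable b) {γ : ℝ} (hγ : 1 < γ) (hγq : γ < q)
    {B : ℝ≥0∞} (hB0 : B ≠ 0) (hBt : B ≠ ⊤)
    (hB : ∀ k z, S.A (fun w => b w ^ q) k z ≤ (B * (2 ^ k)⁻¹) ^ q) (z : X)
    (h0 : S.bt q b z ≠ 0) (ht : S.bt q b z ≠ ⊤) :
    S.T (fun w => S.bt q b w ^ γ) z ≤ S.KC (γ / q) * SC γ * B * S.bt q b z ^ (γ - 1) := by
  have hq : 0 < q := by linarith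
  calc S.T (fun w => S.bt q b w ^ γ) z
      ≤ ∑' k : ℤ, (2:ℝ≥0∞) ^ k * (S.KC (γ / q) * (min (S.bt q b z) (B * (2 ^ k)⁻¹)) ^ γ) := by
        refine ENNReal.tsum_le_tsum fun k => ?_
        gcongr
        refine S.bt_int hq hb (by linarith) k z _ ?_ ?_ ?_
        · rw [Ne, ← nonpos_iff_eq_zero, min_le_iff]
          simp [h0, hB0, zpow2_ne_top]
        · exact ne_top_of_le_ne_top ht (min_le_left _ _)
        · intro l hl
          rcases le_total (S.bt q b z) (B * (2 ^ k)⁻¹) with h | h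
          · rw [min_eq_left h]; exact S.A_le_bt q hq b l z
          · rw [min_eq_right h]
            refine (hB l z).trans ?_
            exact ENNReal.rpow_le_rpow (mul_le_mul_right (zpow_inv_anti hl) _) hq.le
    _ = S.KC (γ / q) * ∑' k : ℤ, (2:ℝ≥0∞) ^ k * ((min (S.bt q b z) (B * (2 ^ k)⁻¹)) ^ γ) := by
        rw [← ENNReal.tsum_mul_left]
        congr 1; ext k; ring
    _ ≤ S.KC (γ / q) * (SC γ * B * S.bt q b z ^ (γ - 1)) := by
        gcongr
        exact sum_min_le γ hγ _ B h0 ht hB0 hBt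
    _ = _ := by ring

lemma iUnion_Q (z : X) : ⋃ n : ℕ, S.Q (n : ℤ) z = univ := by
  ext w; simpa using S.cover z w

lemma ae_zero_of_A {g : X → ℝ≥0∞} (hg : Measurable g) (z : X)
    (h : ∀ k, S.A g k z = 0) : ∀ᵐ w ∂μ, g w = 0 := by
  have h1 : ∀ n : ℕ, ∀ᵐ w ∂(μ.restrict (S.Q (n:ℤ) z)), g w = 0 := by
    intro n
    have : ∫⁻ w in S.Q (n:ℤ) z, g w ∂μ = 0 := by rw [S.lint_eq, h, mul_zero]
    exact (lintegral_eq_zero_iff hg).1 this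
  have h2 := ae_restrict_iUnion_iff (μ := μ) (fun n : ℕ => S.Q (n:ℤ) z) (fun w => g w = 0)
  rw [S.iUnion_Q z, Measure.restrict_univ] at h2
  exact h2.2 h1

lemma bt_ae_top {q : ℝ} {b : X → ℝ≥0∞} (hb : Measurable b) (hq : 1 < q)
    {B : ℝ≥0∞} (hB0 : B ≠ 0) (hBt : B ≠ ⊤)
    (hB : ∀ k z, S.A (fun w => b w ^ q) k z ≤ (B * (2 ^ k)⁻¹) ^ q) [Nonempty X] :
    ∀ᵐ w ∂μ, S.bt q b w ≠ ⊤ := by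
  obtain ⟨z⟩ := ‹Nonempty X›
  have h1 : ∀ n : ℕ, ∀ᵐ w ∂(μ.restrict (S.Q (n:ℤ) z)), S.bt q b w ≠ ⊤ := by
    intro n
    have h := S.bt_int (by linarith) hb one_pos (n:ℤ) z (B * (2 ^ (n:ℤ))⁻¹)
      (mul_ne_zero hB0 (by simp)) (ENNReal.mul_ne_top hBt (by simp)) (fun l hl =>
        (hB l z).trans (ENNReal.rpow_le_rpow (mul_le_mul_right (zpow_inv_anti hl) _) (by linarith)))
    have h3 : ∫⁻ w in S.Q (n:ℤ) z, S.bt q b w ∂μ ≠ ⊤ := by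
      simp only [ENNReal.rpow_one] at h
      rw [S.lint_eq]
      refine ENNReal.mul_ne_top (S.V_top _) (ne_top_of_le_ne_top ?_ h)
      refine ENNReal.mul_ne_top (S.KC_top _ (by positivity) ?_)
        (ENNReal.mul_ne_top hBt (by simp))
      rw [div_lt_one (by linarith)]; exact hq
    filter_upwards [ae_lt_top (S.meas_bt q hb) h3] with w hw using hw.ne
  have h2 := ae_restrict_iUnion_iff (μ := μ) (fun n : ℕ => S.Q (n:ℤ) z) (fun w => S.bt q b w ≠ ⊤)
  rw [S.iUnion_Q z, Measure.restrict_univ] at h2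
  exact h2.2 h1

/-- The constant in the main potential estimate. -/
def MC (p q : ℝ) : ℝ≥0∞ :=
  (S.KC ((q / p) / q) * SC (q / p)) ^ (p - 1) *
    (S.KC ((p + (q / p - 1) * (p - 1)) / q) * SC (p + (q / p - 1) * (p - 1)))

lemma gam_lt {p q : ℝ} (hp : 1 < p) (hpq : p < q) :
    1 < q / p ∧ q / p < q ∧ 1 < p + (q / p - 1) * (p - 1) ∧ p + (q / p - 1) * (p - 1) < q := by
  have h1 : 1 < q / p := by rw [one_lt_div (by linarith)]; exact hpq
  have h3 : q / p * p = q := div_mul_cancel₀ _ (by linarith)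
  refine ⟨h1, by nlinarith, by nlinarith, by nlinarith⟩

lemma MC_top {p q : ℝ} (hp : 1 < p) (hpq : p < q) : S.MC p q ≠ ⊤ := by
  obtain ⟨h1, h2, h3, h4⟩ := gam_lt hp hpq
  have hq : 0 < q := by linarith
  refine ENNReal.mul_ne_top (ENNReal.rpow_ne_top_of_nonneg (by linarith)
    (ENNReal.mul_ne_top (S.KC_top _ (by positivity) ?_) (SC_top _ h1)))
    (ENNReal.mul_ne_top (S.KC_top _ (by positivity) ?_) (SC_top _ h3))
  · rwa [div_lt_one hq]
  · rwa [div_lt_one hq]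

theorem main {p q : ℝ} (hp : 1 < p) (hpq : p < q) {b : X → ℝ≥0∞} (hb : Measurable b)
    {B : ℝ≥0∞} (hBt : B ≠ ⊤)
    (hB : ∀ k z, S.A (fun w => b w ^ q) k z ≤ (B * (2 ^ k)⁻¹) ^ q) [Nonempty X]
    {f : X → ℝ≥0∞} (hf : Measurable f) :
    ∫⁻ z, b z ^ p * S.T f z ^ p ∂μ ≤ S.MC p q * B ^ p * ∫⁻ z, f z ^ p ∂μ := by
  obtain ⟨hg1, hg2, hg3, hg4⟩ := gam_lt hp hpq
  have hq : 0 < q := by linarith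
  have hp0 : 0 < p := by linarith
  by_cases hz : ∃ z, ∀ k, S.A (fun w => b w ^ q) k z = 0
  · obtain ⟨z, hz⟩ := hz
    have h := S.ae_zero_of_A (hb.pow_const q) z hz
    have : ∫⁻ z, b z ^ p * S.T f z ^ p ∂μ = 0 := by
      rw [lintegral_congr_ae (g := fun _ => 0), lintegral_zero]
      filter_upwards [h] with w hw
      have hw' : b w = 0 := by simpa [hq, hq.le, not_lt.2 hq.le] using hw
      simp [hw', hp0]
    rw [this]; exact zero_le
  push Not at hz
  have hbt0 : ∀ z, S.bt q b z ≠ 0 := by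
    intro z h0
    obtain ⟨k, hk⟩ := hz z
    have := S.A_le_bt q hq b k z
    rw [h0, ENNReal.zero_rpow_of_pos hq] at this
    exact hk (le_antisymm this (zero_le))
  have hB0 : B ≠ 0 := by
    rintro rfl
    obtain ⟨z⟩ := ‹Nonempty X›
    obtain ⟨k, hk⟩ := hz z
    have := hB k z
    rw [zero_mul, ENNReal.zero_rpow_of_pos hq] at this
    exact hk (le_antisymm this (zero_le))
  have hbtt := S.bt_ae_top hb (by linarith) hB0 hBt hB
  set β := S.bt q b with hβ
  have hβm : Measurable β := S.meas_bt q hb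
  set e := q / p with he
  set γ := p + (e - 1) * (p - 1) with hγ
  set F : X → ℝ≥0∞ := fun w => β w ^ (-(e * (p - 1))) * f w ^ p with hF
  have hFm : Measurable F := (hβm.pow_const _).mul (hf.pow_const _)
  -- Hoelder
  have hold : ∀ z, S.T f z ^ p ≤ S.T F z * S.T (fun w => β w ^ e) z ^ (p - 1) := by
    intro z
    set ν := μ.withDensity (S.K z) with hν
    have hT : ∀ {φ : X → ℝ≥0∞}, Measurable φ → S.T φ z = ∫⁻ w, φ w ∂ν := by
      intro φ hφ
      rw [S.T_eq hφ, hν, lintegral_withDensity_eq_lintegral_mul _ (S.meas_K_right z) hφ]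
      rfl
    have hac : ∀ᵐ w ∂ν, β w ≠ ⊤ := (withDensity_absolutelyContinuous μ (S.K z)).ae_le hbtt
    set a := e * (p - 1) / p with ha
    have hconj : p.HolderConjugate (p / (p - 1)) := by
      exact Real.HolderConjugate.conjExponent hp
    have h1 : ∫⁻ w, f w ∂ν = ∫⁻ w, ((fun w => β w ^ (-a) * f w) * (fun w => β w ^ a)) w ∂ν := by
      refine lintegral_congr_ae ?_
      filter_upwards [hac] with w hw
      simp only [Pi.mul_apply]
      rw [mul_right_comm, ← ENNReal.rpow_add _ _ (hbt0 w) hw]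
      simp
    have h2 := ENNReal.lintegral_mul_le_Lp_mul_Lq ν hconj
      (f := fun w => β w ^ (-a) * f w) (g := fun w => β w ^ a)
      ((hβm.pow_const _).mul hf).aemeasurable (hβm.pow_const _).aemeasurable
    rw [← h1] at h2
    rw [hT hf, hT hFm, hT (hβm.pow_const e)]
    calc (∫⁻ w, f w ∂ν) ^ p ≤ _ := ENNReal.rpow_le_rpow h2 hp0.le
      _ = _ := by
        rw [ENNReal.mul_rpow_of_nonneg _ _ hp0.le, ← ENNReal.rpow_mul, ← ENNReal.rpow_mul,
          one_div_mul_cancel hp0.ne', ENNReal.rpow_one]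
        congr 1
        · congr 1; ext w
          rw [ENNReal.mul_rpow_of_nonneg _ _ hp0.le, ← ENNReal.rpow_mul, ha, neg_mul,
            div_mul_cancel₀ _ hp0.ne']
        · congr 1
          · congr 1; ext w
            rw [← ENNReal.rpow_mul, ha]
            congr 1
            have : p - 1 ≠ 0 := by linarith
            field_simp
          · have : p - 1 ≠ 0 := by linarith
            field_simp
  set C1 := S.KC (e / q) * SC e with hC1
  set C2 := S.KC (γ / q) * SC γ with hC2
  have step1 : ∀ᵐ z ∂μ, b z ^ p * S.T f z ^ p ≤
      (C1 * B) ^ (p - 1) * (β z ^ γ * S.T F z) := by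
    filter_upwards [hbtt] with z hzt
    have hTe := S.T_bt_le hb hg1 hg2 hB0 hBt hB z (hbt0 z) hzt
    calc b z ^ p * S.T f z ^ p
        ≤ β z ^ p * (S.T F z * (C1 * B * β z ^ (e - 1)) ^ (p - 1)) := by
          gcongr
          · exact S.le_bt q hq b z
          · refine (hold z).trans ?_
            gcongr
      _ = (C1 * B) ^ (p - 1) * (β z ^ p * β z ^ ((e - 1) * (p - 1)) * S.T F z) := by
          rw [ENNReal.mul_rpow_of_nonneg _ _ (by linarith), ← ENNReal.rpow_mul]
          ring
      _ = _ := by rw [← ENNReal.rpow_add _ _ (hbt0 z) hzt]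
  have step2 : ∫⁻ z, β z ^ γ * S.T F z ∂μ = ∫⁻ w, F w * S.T (fun z => β z ^ γ) w ∂μ := by
    simp_rw [S.T_eq hFm, S.T_eq (hβm.pow_const γ)]
    have e1 : ∀ z, β z ^ γ * ∫⁻ w, S.K z w * F w ∂μ = ∫⁻ w, β z ^ γ * (S.K z w * F w) ∂μ :=
      fun z => (lintegral_const_mul _ ((S.meas_K_right z).mul hFm)).symm
    have e2 : ∀ w, F w * ∫⁻ z, S.K w z * β z ^ γ ∂μ = ∫⁻ z, F w * (S.K w z * β z ^ γ) ∂μ :=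
      fun w => (lintegral_const_mul _ ((S.meas_K_right w).mul (hβm.pow_const γ))).symm
    simp_rw [e1, e2]
    rw [lintegral_lintegral_swap]
    · congr 1; ext w; congr 1; ext z
      rw [S.K_symm z w]; ring
    · refine Measurable.aemeasurable ?_
      exact ((hβm.pow_const γ).comp measurable_fst).mul
        (S.meas_K.mul (hFm.comp measurable_snd))
  calc ∫⁻ z, b z ^ p * S.T f z ^ p ∂μ
      ≤ ∫⁻ z, (C1 * B) ^ (p - 1) * (β z ^ γ * S.T F z) ∂μ := lintegral_mono_ae step1
    _ = (C1 * B) ^ (p - 1) * ∫⁻ w, F w * S.T (fun z => β z ^ γ) w ∂μ := by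
        rw [lintegral_const_mul' _ _ ?_, step2]
        refine ENNReal.rpow_ne_top_of_nonneg (by linarith) (ENNReal.mul_ne_top ?_ hBt)
        exact ENNReal.mul_ne_top (S.KC_top _ (by positivity) (by rwa [div_lt_one hq])) (SC_top _ hg1)
    _ ≤ (C1 * B) ^ (p - 1) * ∫⁻ w, (C2 * B) * f w ^ p ∂μ := by
        refine mul_le_mul_right (lintegral_mono_ae ?_) _
        filter_upwards [hbtt] with w hwt
        have hTe := S.T_bt_le hb hg3 hg4 hB0 hBt hB w (hbt0 w) hwt
        calc F w * S.T (fun z => β z ^ γ) w ≤ F w * (C2 * B * β w ^ (γ - 1)) := by gcongr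
          _ = (β w ^ (-(e * (p - 1))) * β w ^ (γ - 1)) * ((C2 * B) * f w ^ p) := by
            rw [hF]; ring
          _ = _ := by
            rw [← ENNReal.rpow_add _ _ (hbt0 w) hwt]
            have : -(e * (p - 1)) + (γ - 1) = 0 := by rw [hγ]; ring
            rw [this, ENNReal.rpow_zero, one_mul]
    _ = _ := by
        rw [lintegral_const_mul _ (hf.pow_const p), MC, ENNReal.mul_rpow_of_nonneg _ _ (by linarith)]
        have : B ^ p = B ^ (p - 1) * B := by
          nth_rewrite 3 [← ENNReal.rpow_one B]
          rw [← ENNReal.rpow_add _ _ hB0 hBt, sub_add_cancel]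
        rw [this]
        ring
end QSys



/-- symmetric parabolic boxes -/
def Qb (d : ℕ) (k : ℤ) (z : Pt d) : Set (Pt d) :=
  Metric.ball z.1 ((4:ℝ) ^ k) ×ˢ Metric.ball z.2 ((2:ℝ) ^ k)

/-- their volumes -/
def Vb (d : ℕ) (k : ℤ) : ℝ≥0∞ :=
  ENNReal.ofReal (2 * 4 ^ k) *
    (ENNReal.ofReal (((2:ℝ) ^ k) ^ d) * volume (Metric.ball (0 : Ed d) 1))

lemma four_zpow (k : ℤ) : (4:ℝ) ^ k = (2 ^ k) ^ 2 := by
  rw [← zpow_natCast, ← zpow_mul, mul_comm, zpow_mul]; norm_num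

lemma vol_Qb (d : ℕ) (k : ℤ) (z : Pt d) : volume (Qb d k z) = Vb d k := by
  rw [Qb, Measure.volume_eq_prod, Measure.prod_prod, Real.volume_ball,
    Measure.addHaar_ball_of_pos _ _ (by positivity), Vb, finrank_euclideanSpace_fin]

lemma volball_zero (d : ℕ) : volume (Metric.ball (0 : Ed d) 1) ≠ 0 :=
  (Metric.measure_ball_pos _ _ one_pos).ne'

lemma volball_top (d : ℕ) : volume (Metric.ball (0 : Ed d) 1) ≠ ⊤ := measure_ball_lt_top.ne

lemma Vb_eq (d : ℕ) (k : ℤ) : Vb d k = ENNReal.ofReal (((2:ℝ) ^ k) ^ (d + 2)) * Vb d 0 := by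
  simp only [Vb, zpow_zero, one_pow, mul_one, ENNReal.ofReal_one, one_mul]
  rw [← mul_assoc, ← mul_assoc, ← ENNReal.ofReal_mul (by positivity), ← ENNReal.ofReal_mul (by positivity),
    four_zpow]
  congr 2
  ring

lemma Vb_succ (d : ℕ) (k : ℤ) : Vb d (k + 1) = ENNReal.ofReal (2 ^ (d + 2)) * Vb d k := by
  rw [Vb_eq, Vb_eq d k, ← mul_assoc, ← ENNReal.ofReal_mul (by positivity), zpow_add_one₀ (by norm_num)]
  congr 2
  ring

/-- The parabolic system. -/
def PS (d : ℕ) : QSys (volume : Measure (Pt d)) where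
  Q := Qb d
  V := Vb d
  D := ENNReal.ofReal (2 ^ (d + 2))
  D_top := ENNReal.ofReal_ne_top
  D_one := by
    rw [← ENNReal.ofReal_one]
    exact ENNReal.ofReal_le_ofReal (one_le_pow₀ (by norm_num))
  V_zero k := by
    refine mul_ne_zero ?_ (mul_ne_zero ?_ (volball_zero d))
    · simp only [ne_eq, ENNReal.ofReal_eq_zero, not_le]; positivity
    · simp only [ne_eq, ENNReal.ofReal_eq_zero, not_le]; positivity
  V_top k := ENNReal.mul_ne_top ENNReal.ofReal_ne_top
    (ENNReal.mul_ne_top ENNReal.ofReal_ne_top (volball_top d))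
  V_succ := Vb_succ d
  meas := vol_Qb d
  isOpen k := by
    have : {p : Pt d × Pt d | p.2 ∈ Qb d k p.1} =
      {p : Pt d × Pt d | dist p.2.1 p.1.1 < 4 ^ k} ∩ {p | dist p.2.2 p.1.2 < 2 ^ k} := rfl
    rw [this]
    exact (isOpen_lt (by fun_prop) (by fun_prop)).inter (isOpen_lt (by fun_prop) (by fun_prop))
  symm k z w h := ⟨by simpa [Metric.mem_ball, dist_comm] using h.1,
    by simpa [Metric.mem_ball, dist_comm] using h.2⟩
  self k z := ⟨Metric.mem_ball_self (by positivity), Metric.mem_ball_self (by positivity)⟩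
  mono k l z h := Set.prod_mono (Metric.ball_subset_ball (zpow_le_zpow_right₀ (by norm_num) h))
    (Metric.ball_subset_ball (zpow_le_zpow_right₀ (by norm_num) h))
  trans k z w v h1 h2 := by
    have a1 := h1.1; have a2 := h1.2; have b1 := h2.1; have b2 := h2.2
    simp only [Metric.mem_ball] at a1 a2 b1 b2
    have p4 : (0:ℝ) < 4 ^ k := by positivity
    refine ⟨?_, ?_⟩
    · simp only [Metric.mem_ball]
      rw [zpow_add_one₀ (by norm_num)]
      have := dist_triangle v.1 w.1 z.1
      linarith
    · simp only [Metric.mem_ball]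
      rw [zpow_add_one₀ (by norm_num)]
      have := dist_triangle v.2 w.2 z.2
      linarith
  cover z w := by
    obtain ⟨n, hn⟩ := pow_unbounded_of_one_lt (max (dist w.1 z.1) (dist w.2 z.2)) (y := (2:ℝ)) (by norm_num)
    refine ⟨n, ?_, ?_⟩
    · simp only [Metric.mem_ball, zpow_natCast]
      exact ((le_max_left _ _).trans_lt hn).trans_le (pow_le_pow_left₀ (by norm_num) (by norm_num) n)
    · simp only [Metric.mem_ball, zpow_natCast]
      exact (le_max_right _ _).trans_lt hn

lemma pCyl_eq (d : ℕ) (ρ : ℝ) (z : Pt d) :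
    pCyl d ρ z = Ico z.1 (z.1 + ρ ^ 2) ×ˢ Metric.ball z.2 ρ := by
  ext w
  simp only [pCyl, mem_ofPred_eq, mem_prod, mem_Ico, Metric.mem_ball, dist_comm]
  tauto

lemma vol_pCyl (d : ℕ) (k : ℤ) (z : Pt d) :
    volume (pCyl d ((2:ℝ) ^ (k + 1)) z) ≤ Vb d (k + 1) := by
  rw [pCyl_eq, Measure.volume_eq_prod, Measure.prod_prod, Real.volume_Ico,
    Measure.addHaar_ball_of_pos _ _ (by positivity), Vb, finrank_euclideanSpace_fin]
  gcongr
  rw [four_zpow]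
  have : (0:ℝ) ≤ (2 ^ (k+1)) ^ 2 := by positivity
  linarith

lemma morrey_A (d : ℕ) (q : ℝ) (hq : 0 < q) (b : Pt d → ℝ≥0∞) (k : ℤ) (z : Pt d) :
    (PS d).A (fun w => b w ^ q) k z ≤
      ((PS d).D ^ (1 / q) * MorreyNorm d q 1 univ b * (2 ^ k)⁻¹) ^ q := by
  set N := MorreyNorm d q 1 univ b with hN
  set ρ : ℝ := 2 ^ (k + 1) with hρ
  have hρ0 : 0 < ρ := by positivity
  set z' : Pt d := (z.1 - 4 ^ k, z.2) with hz'
  have h1 : ENNReal.ofReal ρ * (pAvg d ρ z' fun w => b w ^ q) ^ (1 / q) ≤ N := by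
    rw [hN, MorreyNorm]
    refine le_trans (le_of_eq ?_) (le_iSup₂_of_le ρ hρ0 (le_iSup₂_of_le z' (mem_univ _) le_rfl))
    simp
  have hofρ : ENNReal.ofReal ρ = 2 ^ (k + 1) := by
    rw [hρ, ← Real.rpow_intCast, ← ENNReal.ofReal_rpow_of_pos (by norm_num), ENNReal.rpow_intCast]
    simp
  have hsub : Qb d k z ⊆ pCyl d ρ z' := by
    rintro w ⟨hw1, hw2⟩
    simp only [Metric.mem_ball, Real.dist_eq, abs_lt] at hw1 hw2
    refine ⟨?_, ?_, ?_⟩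
    · rw [dist_comm]
      refine hw2.trans_le (zpow_le_zpow_right₀ (by norm_num) (by omega))
    · simp only [hz']; linarith [hw1.1]
    · simp only [hz', hρ]
      rw [← four_zpow, zpow_add_one₀ (by norm_num)]
      have : (0:ℝ) < 4 ^ k := by positivity
      linarith [hw1.2]
  set J := ∫⁻ w in pCyl d ρ z', b w ^ q with hJ
  have hQJ : ∫⁻ w in Qb d k z, b w ^ q ≤ J := lintegral_mono_set hsub
  have hCV : volume (pCyl d ρ z') ≤ (PS d).D * Vb d k := by
    rw [show (PS d).D * Vb d k = Vb d (k+1) from (Vb_succ d k).symm]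
    exact vol_pCyl d k z'
  have hVQ : Vb d k ≤ volume (pCyl d ρ z') := by
    rw [← vol_Qb d k z]; exact measure_mono hsub
  have hv0 : Vb d k ≠ 0 := (PS d).V_zero k
  have hvt : Vb d k ≠ ⊤ := (PS d).V_top k
  have hc0 : volume (pCyl d ρ z') ≠ 0 := fun h => hv0 (le_antisymm (h ▸ hVQ) (zero_le))
  have hct : volume (pCyl d ρ z') ≠ ⊤ := ne_top_of_le_ne_top
    (ENNReal.mul_ne_top (PS d).D_top hvt) hCV
  have h2 : (PS d).A (fun w => b w ^ q) k z ≤ (PS d).D * (pAvg d ρ z' fun w => b w ^ q) := by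
    change (Vb d k)⁻¹ * ∫⁻ w in Qb d k z, b w ^ q ≤ _
    calc _ ≤ (Vb d k)⁻¹ * J := by gcongr
      _ = (Vb d k)⁻¹ * (volume (pCyl d ρ z') * ((volume (pCyl d ρ z'))⁻¹ * J)) := by
        rw [← mul_assoc (volume _), ENNReal.mul_inv_cancel hc0 hct, one_mul]
      _ ≤ (Vb d k)⁻¹ * (((PS d).D * Vb d k) * ((volume (pCyl d ρ z'))⁻¹ * J)) := by gcongr
      _ = ((Vb d k)⁻¹ * Vb d k) * ((PS d).D * ((volume (pCyl d ρ z'))⁻¹ * J)) := by ring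
      _ = _ := by rw [ENNReal.inv_mul_cancel hv0 hvt, one_mul]; rfl
  have h3 : (pAvg d ρ z' fun w => b w ^ q) ≤ (N * (2 ^ k)⁻¹) ^ q := by
    have h4 : (pAvg d ρ z' fun w => b w ^ q) ^ (1 / q) ≤ N * (2 ^ k)⁻¹ := by
      rw [hofρ] at h1
      have := le_inv_mul_of' (QSys.zpow2_ne_zero _) (QSys.zpow2_ne_top _) h1
      refine this.trans ?_
      rw [mul_comm]
      exact mul_le_mul_right (QSys.zpow_inv_anti (by omega)) _
    calc _ = ((pAvg d ρ z' fun w => b w ^ q) ^ (1 / q)) ^ q := by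
          rw [← ENNReal.rpow_mul, one_div_mul_cancel hq.ne', ENNReal.rpow_one]
      _ ≤ _ := ENNReal.rpow_le_rpow h4 hq.le
  refine h2.trans ?_
  rw [mul_assoc, ENNReal.mul_rpow_of_nonneg _ _ hq.le, ← ENNReal.rpow_mul,
    one_div_mul_cancel hq.ne', ENNReal.rpow_one]
  gcongr



/-- parabolic dilation around `z` -/
def dl (d : ℕ) (z : Pt d) (r : ℝ) (w : Pt d) : Pt d := (z.1 + r ^ 2 * w.1, z.2 + r • w.2)

lemma dl_contDiff (d : ℕ) (z : Pt d) (r : ℝ) {n : WithTop ℕ∞} : ContDiff ℝ n (dl d z r) := by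
  unfold dl; fun_prop

lemma dl_cont (d : ℕ) (z : Pt d) (r : ℝ) : Continuous (dl d z r) := (dl_contDiff d z r (n := 0)).continuous

lemma map_dl (d : ℕ) (z : Pt d) (r : ℝ) (hr : 0 < r) :
    Measure.map (dl d z r) volume = ENNReal.ofReal ((r ^ (d + 2))⁻¹) • (volume : Measure (Pt d)) := by
  have h1 : Measure.map (fun s : ℝ => z.1 + r ^ 2 * s) volume =
      ENNReal.ofReal ((r ^ 2)⁻¹) • (volume : Measure ℝ) := by
    have e : (fun s : ℝ => z.1 + r ^ 2 * s) = (fun s => z.1 + s) ∘ (fun s => (r ^ 2) • s) := rfl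
    rw [e, ← Measure.map_map (by fun_prop) (by fun_prop), Measure.map_addHaar_smul _ (by positivity),
      Measure.map_smul, map_add_left_eq_self, abs_of_pos (by positivity)]
    simp
  have h2 : Measure.map (fun s : Ed d => z.2 + r • s) volume =
      ENNReal.ofReal ((r ^ d)⁻¹) • (volume : Measure (Ed d)) := by
    have e : (fun s : Ed d => z.2 + r • s) = (fun s => z.2 + s) ∘ (fun s => r • s) := rfl
    rw [e, ← Measure.map_map (by fun_prop) (by fun_prop), Measure.map_addHaar_smul _ (by positivity),
      Measure.map_smul, map_add_left_eq_self, abs_of_pos (by positivity)]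
    simp
  have h3 : dl d z r = Prod.map (fun s : ℝ => z.1 + r ^ 2 * s) (fun s : Ed d => z.2 + r • s) := rfl
  rw [h3, Measure.volume_eq_prod, ← Measure.map_prod_map _ _ (by fun_prop) (by fun_prop), h1, h2,
    Measure.prod_smul_left, Measure.prod_smul_right, smul_smul, ← ENNReal.ofReal_mul (by positivity)]
  congr 2
  rw [← mul_inv, pow_add, mul_comm]

lemma lint_dl (d : ℕ) (z : Pt d) (r : ℝ) (hr : 0 < r) {f : Pt d → ℝ≥0∞} (hf : Measurable f) :
    ∫⁻ w, f (dl d z r w) = ENNReal.ofReal ((r ^ (d + 2))⁻¹) * ∫⁻ w, f w := by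
  rw [← lintegral_map hf (dl_cont d z r).measurable, map_dl d z r hr, lintegral_smul_measure]
  rfl

lemma lint_dl_ball (d : ℕ) (z : Pt d) (k : ℤ) (r : ℝ) (hr1 : 2 ^ k ≤ r) (hr2 : r ≤ 2 ^ (k + 1))
    {f : Pt d → ℝ≥0∞} (hf : Measurable f) :
    ∫⁻ w in Metric.ball 0 1, f (dl d z r w) ≤ ((PS d).D * Vb d 0) * (PS d).A f (k + 1) z := by
  have hk : (0:ℝ) < 2 ^ k := by positivity
  have hr : 0 < r := hk.trans_le hr1
  have hQm : MeasurableSet (Qb d (k+1) z) := (PS d).measurableSet_Q (k+1) z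
  calc ∫⁻ w in Metric.ball 0 1, f (dl d z r w)
      ≤ ∫⁻ w, (Qb d (k+1) z).indicator f (dl d z r w) := by
        rw [← lintegral_indicator Metric.isOpen_ball.measurableSet]
        refine lintegral_mono fun w => ?_
        by_cases hw : w ∈ Metric.ball (0 : Pt d) 1
        swap
        · rw [indicator_of_notMem hw]; exact zero_le
        rw [indicator_of_mem hw, indicator_of_mem]
        rw [mem_ball_zero_iff, Prod.norm_def, max_lt_iff, Real.norm_eq_abs] at hw
        refine ⟨?_, ?_⟩
        · rw [Metric.mem_ball, Real.dist_eq, four_zpow]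
          simp only [dl, add_sub_cancel_left, abs_mul, abs_pow, abs_of_pos hr]
          calc r ^ 2 * |w.1| < r ^ 2 * 1 := by gcongr; exact hw.1
            _ ≤ (2 ^ (k + 1)) ^ 2 := by rw [mul_one]; gcongr
        · rw [Metric.mem_ball, dist_eq_norm]
          simp only [dl, add_sub_cancel_left, norm_smul, Real.norm_eq_abs, abs_of_pos hr]
          calc r * ‖w.2‖ < r * 1 := by gcongr; exact hw.2
            _ ≤ 2 ^ (k + 1) := by rw [mul_one]; exact hr2
    _ = ENNReal.ofReal ((r ^ (d + 2))⁻¹) * ∫⁻ w in Qb d (k+1) z, f w := by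
        rw [lint_dl d z r hr (hf.indicator hQm),
          lintegral_indicator hQm]
    _ ≤ ENNReal.ofReal ((((2:ℝ) ^ k) ^ (d + 2))⁻¹) * (Vb d (k+1) * (PS d).A f (k + 1) z) := by
        gcongr
        exact ((PS d).lint_eq f (k+1) z).le
    _ = _ := by
        rw [Vb_succ, Vb_eq]
        have : ENNReal.ofReal ((((2:ℝ) ^ k) ^ (d + 2))⁻¹) * ENNReal.ofReal (((2:ℝ) ^ k) ^ (d + 2)) = 1 := by
          rw [← ENNReal.ofReal_mul (by positivity), inv_mul_cancel₀ (by positivity), ENNReal.ofReal_one]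
        change _ = (ENNReal.ofReal (2 ^ (d + 2)) * Vb d 0) * (PS d).A f (k + 1) z
        calc _ = (ENNReal.ofReal ((((2:ℝ) ^ k) ^ (d + 2))⁻¹) * ENNReal.ofReal (((2:ℝ) ^ k) ^ (d + 2))) *
              ((ENNReal.ofReal (2 ^ (d + 2)) * Vb d 0) * (PS d).A f (k + 1) z) := by ring
          _ = _ := by rw [this, one_mul]

/-- the bump -/
def bumpf (d : ℕ) : ContDiffBump (0 : Pt d) := ⟨1/4, 1/2, by norm_num, by norm_num⟩

/-- normalized bump -/
def ph (d : ℕ) : Pt d → ℝ := (bumpf d).normed volume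

lemma ph_cd (d : ℕ) : ContDiff ℝ (⊤ : ℕ∞) (ph d) := (bumpf d).contDiff_normed
lemma ph_cs (d : ℕ) : HasCompactSupport (ph d) := (bumpf d).hasCompactSupport_normed
lemma ph_int (d : ℕ) : ∫ w, ph d w = 1 := (bumpf d).integral_normed
lemma ph_supp (d : ℕ) : tsupport (ph d) ⊆ Metric.ball 0 1 := by
  rw [ph, ContDiffBump.tsupport_normed_eq]
  exact Metric.closedBall_subset_ball (by norm_num [bumpf])

/-- weighted bump -/
def ps (d : ℕ) (w : Pt d) : ℝ := w.1 * ph d w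

/-- derivative of the weighted bump -/
def psd (d : ℕ) (i : Fin d) (w : Pt d) : ℝ := spDeriv d i (ps d) w

lemma ps_cd (d : ℕ) : ContDiff ℝ (⊤ : ℕ∞) (ps d) := contDiff_fst.mul (ph_cd d)
lemma ps_cs (d : ℕ) : HasCompactSupport (ps d) := (ph_cs d).mul_left

lemma spDeriv_cd {d : ℕ} {u : Pt d → ℝ} (hu : ContDiff ℝ (⊤ : ℕ∞) u) (i : Fin d) :
    ContDiff ℝ (⊤ : ℕ∞) (spDeriv d i u) :=
  (hu.fderiv_right (by norm_cast)).clm_apply contDiff_const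

lemma spDeriv_cs {d : ℕ} {u : Pt d → ℝ} (hu : HasCompactSupport u) (i : Fin d) :
    HasCompactSupport (spDeriv d i u) := hu.fderiv_apply ℝ _

lemma timeDeriv_cd {d : ℕ} {u : Pt d → ℝ} (hu : ContDiff ℝ (⊤ : ℕ∞) u) :
    ContDiff ℝ (⊤ : ℕ∞) (timeDeriv d u) :=
  (hu.fderiv_right (by norm_cast)).clm_apply contDiff_const

lemma psd_supp (d : ℕ) (i : Fin d) (w : Pt d) (hw : w ∉ Metric.ball (0 : Pt d) 1) : psd d i w = 0 := by
  have h1 : w ∉ tsupport (ps d) := fun h => hw (ph_supp d (tsupport_mul_subset_right h))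
  have h2 : fderiv ℝ (ps d) w = 0 := by
    by_contra hne
    exact h1 (support_fderiv_subset ℝ hne)
  simp [psd, spDeriv, h2]

lemma mixed_symm {d : ℕ} {u : Pt d → ℝ} (hu : ContDiff ℝ (⊤ : ℕ∞) u) (i : Fin d) (x : Pt d) :
    timeDeriv d (spDeriv d i u) x = spDeriv d i (timeDeriv d u) x := by
  have hd : DifferentiableAt ℝ (fderiv ℝ u) x :=
    ((hu.fderiv_right (m := 1) (by norm_cast)).differentiable (by norm_num)) x
  have hs : IsSymmSndFDerivAt ℝ u x := hu.contDiffAt.isSymmSndFDerivAt (by simp; norm_cast)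
  have key : ∀ a b : Pt d, fderiv ℝ (fun y => fderiv ℝ u y a) x b = fderiv ℝ (fderiv ℝ u) x b a := by
    intro a b
    rw [fderiv_clm_apply hd (differentiableAt_const a)]
    simp
  unfold timeDeriv spDeriv
  rw [key, key]
  exact hs.eq _ _

/-- right-hand side density -/
def f0 (d : ℕ) (u : Pt d → ℝ) (z : Pt d) : ℝ≥0∞ :=
  ENNReal.ofReal |timeDeriv d u z| + ENNReal.ofReal (hessNorm d u z)

lemma hess_cont {d : ℕ} {u : Pt d → ℝ} (hu : ContDiff ℝ (⊤ : ℕ∞) u) : Continuous (hessNorm d u) := by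
  unfold hessNorm
  refine Real.continuous_sqrt.comp ?_
  refine continuous_finsetSum _ fun i _ => continuous_finsetSum _ fun j _ => ?_
  exact ((spDeriv_cd (spDeriv_cd hu j) i).continuous).pow 2

lemma f0_meas {d : ℕ} {u : Pt d → ℝ} (hu : ContDiff ℝ (⊤ : ℕ∞) u) : Measurable (f0 d u) := by
  unfold f0
  have h1 := (timeDeriv_cd hu).continuous.measurable
  have h2 := (hess_cont hu).measurable
  fun_prop

lemma abs_spDeriv2_le (d : ℕ) (u : Pt d → ℝ) (i j : Fin d) (z : Pt d) :
    |spDeriv d i (spDeriv d j u) z| ≤ hessNorm d u z := by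
  refine Real.abs_le_sqrt ?_
  calc spDeriv d i (spDeriv d j u) z ^ 2 ≤ ∑ j : Fin d, spDeriv d i (spDeriv d j u) z ^ 2 :=
        Finset.single_le_sum (f := fun j => spDeriv d i (spDeriv d j u) z ^ 2)
          (fun _ _ => sq_nonneg _) (Finset.mem_univ j)
    _ ≤ _ := Finset.single_le_sum (f := fun i => ∑ j : Fin d, spDeriv d i (spDeriv d j u) z ^ 2)
          (fun _ _ => Finset.sum_nonneg fun _ _ => sq_nonneg _) (Finset.mem_univ i)

/-- the mollified derivative -/
def FF (d : ℕ) (v : Pt d → ℝ) (z : Pt d) (r : ℝ) : ℝ := ∫ w, v (dl d z r w) * ph d w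

lemma hasDeriv_FF {d : ℕ} {v : Pt d → ℝ} (hv : ContDiff ℝ (⊤ : ℕ∞) v) (hc : HasCompactSupport v)
    (z : Pt d) (r : ℝ) :
    HasDerivAt (FF d v z)
      (∫ w, fderiv ℝ v (dl d z r w) (2 * r * w.1, w.2) * ph d w) r := by
  have hdv : Continuous (fderiv ℝ v) := hv.continuous_fderiv (by simp)
  obtain ⟨Mv, hMv⟩ := (hc.fderiv ℝ).exists_bound_of_continuous hdv
  have hMv0 : 0 ≤ Mv := (norm_nonneg _).trans (hMv 0)
  have hphc := (ph_cd d).continuous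
  have hphi : Integrable (ph d) := hphc.integrable_of_hasCompactSupport (ph_cs d)
  refine (hasDerivAt_integral_of_dominated_loc_of_deriv_le (μ := volume)
    (F := fun r w => v (dl d z r w) * ph d w)
    (F' := fun r w => fderiv ℝ v (dl d z r w) (2 * r * w.1, w.2) * ph d w)
    (bound := fun w => Mv * (2 * (|r| + 1) + 1) * |ph d w|)
    (s := Metric.ball r 1) (Metric.ball_mem_nhds r one_pos) ?_ ?_ ?_ ?_ ?_ ?_).2
  · refine Eventually.of_forall fun r => Continuous.aestronglyMeasurable ?_
    exact (hv.continuous.comp (dl_cont d z r)).mul hphc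
  · refine Continuous.integrable_of_hasCompactSupport ?_ (ph_cs d).mul_left
    exact (hv.continuous.comp (dl_cont d z r)).mul hphc
  · refine Continuous.aestronglyMeasurable ?_
    exact ((hdv.comp (dl_cont d z r)).clm_apply (by fun_prop)).mul hphc
  · refine Eventually.of_forall fun w x hx => ?_
    by_cases hw : ph d w = 0
    · simp [hw]
    have hwb : w ∈ Metric.ball (0 : Pt d) 1 := ph_supp d (subset_tsupport _ hw)
    rw [mem_ball_zero_iff, Prod.norm_def, max_lt_iff, Real.norm_eq_abs] at hwb
    rw [norm_mul, Real.norm_eq_abs (ph d w)]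
    gcongr
    refine (ContinuousLinearMap.le_opNorm _ _).trans ?_
    gcongr
    · exact hMv _
    · rw [Metric.mem_ball, Real.dist_eq] at hx
      have hx' : |x| ≤ |r| + 1 := by
        have := abs_add_le (x - r) r
        rw [sub_add_cancel] at this; linarith
      have hr0 := abs_nonneg r
      rw [Prod.norm_def]
      refine max_le ?_ ?_
      · simp only [Real.norm_eq_abs, abs_mul, abs_two]
        have : |x| * |w.1| ≤ (|r| + 1) * 1 := mul_le_mul hx' hwb.1.le (abs_nonneg _) (by linarith)
        nlinarith
      · simp only; linarith [hwb.2]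
  · exact (hphi.abs).const_mul _
  · refine Eventually.of_forall fun w x _ => ?_
    have h1 : HasDerivAt (fun x => dl d z x w) (2 * x * w.1, w.2) x := by
      unfold dl
      refine HasDerivAt.prodMk ?_ ?_
      · have := (((hasDerivAt_id x).pow 2).mul_const w.1).const_add z.1
        simpa using this
      · have := ((hasDerivAt_id x).smul_const w.2).const_add z.2
        simpa using this
    have h2 : HasFDerivAt v (fderiv ℝ v (dl d z x w)) (dl d z x w) :=
      (hv.differentiable (by simp) _).hasFDerivAt
    exact (h2.comp_hasDerivAt x h1).mul_const _

lemma deriv_ibp {d : ℕ} {u : Pt d → ℝ} (hu : ContDiff ℝ (⊤ : ℕ∞) u) (i : Fin d)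
    (z : Pt d) (r : ℝ) :
    ∫ w, fderiv ℝ (spDeriv d i u) (dl d z r w) (2 * r * w.1, w.2) * ph d w =
      ∫ w, (-2 * psd d i w * timeDeriv d u (dl d z r w) +
        fderiv ℝ (spDeriv d i u) (dl d z r w) (0, w.2) * ph d w) := by
  have hv := spDeriv_cd hu i
  have hut := timeDeriv_cd hu
  set g : Pt d → ℝ := fun w => timeDeriv d u (dl d z r w) with hg
  have hgc : ContDiff ℝ (⊤ : ℕ∞) g := hut.comp (dl_contDiff d z r)
  set e : Pt d := ((0:ℝ), EuclideanSpace.single i (1:ℝ)) with he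
  have hgd : ∀ w, fderiv ℝ g w e = r * timeDeriv d (spDeriv d i u) (dl d z r w) := by
    intro w
    rw [mixed_symm hu i]
    have h1 : HasFDerivAt (timeDeriv d u) (fderiv ℝ (timeDeriv d u) (dl d z r w)) (dl d z r w) :=
      (hut.differentiable (by simp) _).hasFDerivAt
    have hline : HasDerivAt (fun s : ℝ => w + s • e) e 0 := by
      have := ((hasDerivAt_id (0:ℝ)).smul_const e).const_add w
      simpa using this
    have h3 : HasDerivAt (fun s : ℝ => dl d z r (w + s • e))
        ((0:ℝ), r • EuclideanSpace.single i (1:ℝ)) 0 := by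
      have e1 : (fun s : ℝ => dl d z r (w + s • e)) = fun s : ℝ => dl d z r w +
          s • ((0:ℝ), r • (EuclideanSpace.single i (1:ℝ) : Ed d)) := by
        ext1 s
        simp only [dl, he]
        ext1
        · simp
        · simp only [Prod.snd_add, Prod.smul_snd, smul_add, add_assoc]
          rw [smul_comm]
      rw [e1]
      have := ((hasDerivAt_id (0:ℝ)).smul_const
        ((0:ℝ), r • (EuclideanSpace.single i (1:ℝ) : Ed d))).const_add (dl d z r w)
      simpa using this
    have h4 : HasDerivAt (fun s : ℝ => g (w + s • e)) (fderiv ℝ g w e) 0 := by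
      have : HasFDerivAt g (fderiv ℝ g w) (w + (0:ℝ) • e) := by
        simpa using (hgc.differentiable (by simp) w).hasFDerivAt
      exact this.comp_hasDerivAt (0:ℝ) hline
    have h5 : HasDerivAt (fun s : ℝ => g (w + s • e))
        (fderiv ℝ (timeDeriv d u) (dl d z r w) ((0:ℝ), r • EuclideanSpace.single i (1:ℝ))) 0 := by
      have : HasFDerivAt (timeDeriv d u) (fderiv ℝ (timeDeriv d u) (dl d z r w))
          (dl d z r (w + (0:ℝ) • e)) := by simpa using h1
      exact this.comp_hasDerivAt (0:ℝ) h3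
    rw [h4.unique h5]
    have : ((0:ℝ), r • (EuclideanSpace.single i (1:ℝ) : Ed d)) = r • e := by
      simp [he]
    rw [this, map_smul, smul_eq_mul]
    rfl
  have hps := ps_cd d
  have hpsdc : Continuous (fun w => fderiv ℝ (ps d) w e) := (spDeriv_cd hps i).continuous
  have hgdc : Continuous (fun w => fderiv ℝ g w e) := (spDeriv_cd hgc i).continuous
  have : (volume : Measure (Pt d)).IsAddHaarMeasure := by
    rw [Measure.volume_eq_prod]; infer_instance
  have ibp := integral_mul_fderiv_eq_neg_fderiv_mul_of_integrable (μ := (volume : Measure (Pt d)))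
    (f := ps d) (g := g) (v := e)
    ((hpsdc.mul hgc.continuous).integrable_of_hasCompactSupport
      (((ps_cs d).fderiv_apply ℝ e).mul_right))
    ((hps.continuous.mul hgdc).integrable_of_hasCompactSupport (ps_cs d).mul_right)
    ((hps.continuous.mul hgc.continuous).integrable_of_hasCompactSupport (ps_cs d).mul_right)
    (fun x _ => hps.differentiable (by simp) x) (fun x _ => hgc.differentiable (by simp) x)
  have hdv : Continuous (fderiv ℝ (spDeriv d i u)) := hv.continuous_fderiv (by simp)
  have hI2 : Integrable (fun w => fderiv ℝ (spDeriv d i u) (dl d z r w) ((0:ℝ), w.2) * ph d w) := by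
    refine Continuous.integrable_of_hasCompactSupport ?_ (ph_cs d).mul_left
    exact ((hdv.comp (dl_cont d z r)).clm_apply (by fun_prop)).mul (ph_cd d).continuous
  have hsplit : ∀ w, fderiv ℝ (spDeriv d i u) (dl d z r w) (2 * r * w.1, w.2) * ph d w =
      2 * (ps d w * fderiv ℝ g w e) +
        fderiv ℝ (spDeriv d i u) (dl d z r w) ((0:ℝ), w.2) * ph d w := by
    intro w
    have : ((2 * r * w.1, w.2) : Pt d) = (2 * r * w.1) • ((1:ℝ), (0 : Ed d)) + ((0:ℝ), w.2) := by
      ext1 <;> simp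
    rw [this, map_add, map_smul, hgd, ps, smul_eq_mul]
    change (2 * r * w.1 * timeDeriv d (spDeriv d i u) (dl d z r w) + _) * _ = _
    ring
  simp_rw [hsplit]
  rw [integral_add _ hI2, integral_const_mul, ibp, integral_add _ hI2]
  · congr 1
    rw [← integral_neg, ← integral_const_mul]
    congr 1; ext w
    simp only [psd, spDeriv]
    ring
  · refine Continuous.integrable_of_hasCompactSupport ?_ ?_
    · exact (continuous_const.mul (spDeriv_cd hps i).continuous).mul hgc.continuous
    · exact HasCompactSupport.mul_right ((spDeriv_cs (ps_cs d) i).mul_left)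
  · exact ((hps.continuous.mul hgdc).integrable_of_hasCompactSupport (ps_cs d).mul_right).const_mul 2

lemma deriv_bound (d : ℕ) (i : Fin d) : ∃ C : ℝ, 0 < C ∧ ∀ u : Pt d → ℝ, ContDiff ℝ (⊤ : ℕ∞) u →
    HasCompactSupport u → ∀ z r, ‖deriv (FF d (spDeriv d i u) z) r‖ₑ ≤
      ENNReal.ofReal C * ∫⁻ w in Metric.ball 0 1, f0 d u (dl d z r w) := by
  obtain ⟨C1, hC1⟩ := (spDeriv_cs (ps_cs d) i).exists_bound_of_continuous (spDeriv_cd (ps_cd d) i).continuous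
  obtain ⟨C2, hC2⟩ := (ph_cs d).exists_bound_of_continuous (ph_cd d).continuous
  have h10 : 0 ≤ C1 := (norm_nonneg _).trans (hC1 0)
  have h20 : 0 ≤ C2 := (norm_nonneg _).trans (hC2 0)
  refine ⟨2 * C1 + d * C2 + 1, by positivity, ?_⟩
  intro u hu hc z r
  rw [(hasDeriv_FF (spDeriv_cd hu i) (spDeriv_cs hc i) z r).deriv, deriv_ibp hu i z r]
  refine (enorm_integral_le_lintegral_enorm _).trans ?_
  have hm : Measurable (fun w => f0 d u (dl d z r w)) := (f0_meas hu).comp (dl_cont d z r).measurable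
  rw [← lintegral_const_mul _ hm,
    ← lintegral_indicator Metric.isOpen_ball.measurableSet]
  refine lintegral_mono fun w => ?_
  by_cases hw : w ∈ Metric.ball (0 : Pt d) 1
  · rw [indicator_of_mem hw]
    rw [mem_ball_zero_iff, Prod.norm_def, max_lt_iff, Real.norm_eq_abs] at hw
    have hh0 : 0 ≤ hessNorm d u (dl d z r w) := Real.sqrt_nonneg _
    rw [f0, ← ENNReal.ofReal_add (abs_nonneg _) hh0, ← ENNReal.ofReal_mul (by positivity),
      ← ofReal_norm]
    refine ENNReal.ofReal_le_ofReal ?_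
    have hw2 : ((0:ℝ), w.2) = ∑ j : Fin d, (w.2 j) • ((0:ℝ), (EuclideanSpace.single j (1:ℝ) : Ed d)) := by
      ext1
      · simp [Prod.fst_sum]
      · rw [Prod.snd_sum]
        ext j
        simp [Finset.sum_apply, Pi.single_apply]
    have hB : |fderiv ℝ (spDeriv d i u) (dl d z r w) ((0:ℝ), w.2)| ≤ d * hessNorm d u (dl d z r w) := by
      rw [hw2, map_sum]
      refine (Finset.abs_sum_le_sum_abs _ _).trans ?_
      calc _ ≤ ∑ j : Fin d, hessNorm d u (dl d z r w) := by
            refine Finset.sum_le_sum fun j _ => ?_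
            rw [map_smul, smul_eq_mul, abs_mul]
            have h1 : |w.2 j| ≤ 1 := (PiLp.norm_apply_le w.2 j).trans hw.2.le
            calc _ ≤ 1 * hessNorm d u (dl d z r w) :=
                  mul_le_mul h1 (abs_spDeriv2_le d u j i _) (abs_nonneg _) zero_le_one
              _ = _ := one_mul _
        _ = _ := by simp
    have hA : |psd d i w| ≤ C1 := hC1 w
    have hP : |ph d w| ≤ C2 := hC2 w
    have ht0 := abs_nonneg (timeDeriv d u (dl d z r w))
    rw [Real.norm_eq_abs]
    calc _ ≤ |-2 * psd d i w * timeDeriv d u (dl d z r w)| +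
          |fderiv ℝ (spDeriv d i u) (dl d z r w) ((0:ℝ), w.2) * ph d w| := abs_add_le _ _
      _ ≤ 2 * C1 * |timeDeriv d u (dl d z r w)| + (d * hessNorm d u (dl d z r w)) * C2 := by
          rw [abs_mul, abs_mul, abs_mul]
          gcongr
          norm_num
      _ ≤ _ := by
          have : (0:ℝ) ≤ d := by positivity
          nlinarith [mul_nonneg (mul_nonneg this h20) ht0, mul_nonneg h10 hh0]
  · rw [indicator_of_notMem hw, psd_supp d i w hw]
    have : ph d w = 0 := by
      by_contra h
      exact hw (ph_supp d (subset_tsupport _ h))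
    simp [this]



lemma ofReal_two_zpow (k : ℤ) : ENNReal.ofReal ((2:ℝ) ^ k) = 2 ^ k := by
  rw [← Real.rpow_intCast, ← ENNReal.ofReal_rpow_of_pos (by norm_num), ENNReal.rpow_intCast]
  simp

lemma FF_step {d : ℕ} {v : Pt d → ℝ} (hv : ContDiff ℝ (⊤ : ℕ∞) v) (hc : HasCompactSupport v)
    (z : Pt d) (k : ℤ) (M : ℝ≥0∞)
    (hM : ∀ r : ℝ, 2 ^ k ≤ r → r ≤ 2 ^ (k + 1) → ‖deriv (FF d v z) r‖ₑ ≤ M) :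
    edist (FF d v z (2 ^ k)) (FF d v z (2 ^ (k + 1))) ≤ M * 2 ^ (k + 1) := by
  by_cases hMt : M = ⊤
  · rw [hMt, ENNReal.top_mul (QSys.zpow2_ne_zero _)]; exact le_top
  have hk : (0:ℝ) < 2 ^ k := by positivity
  have h2 : (2:ℝ) ^ (k + 1) = 2 ^ k * 2 := zpow_add_one₀ (by norm_num) k
  have hle : (2:ℝ) ^ k ≤ 2 ^ (k + 1) := by rw [h2]; linarith
  have h := Convex.norm_image_sub_le_of_norm_deriv_le (𝕜 := ℝ) (f := FF d v z) (C := M.toReal)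
    (s := Icc ((2:ℝ) ^ k) (2 ^ (k + 1))) (x := 2 ^ (k + 1)) (y := 2 ^ k)
    (fun x _ => (hasDeriv_FF hv hc z x).differentiableAt)
    (fun x hx => by
      have := ENNReal.toReal_mono hMt (hM x hx.1 hx.2)
      simpa using this)
    (convex_Icc _ _) ⟨hle, le_rfl⟩ ⟨le_rfl, hle⟩
  rw [edist_eq_enorm_sub, ← ofReal_norm]
  calc _ ≤ ENNReal.ofReal (M.toReal * 2 ^ (k + 1)) := by
        refine ENNReal.ofReal_le_ofReal (h.trans ?_)
        gcongr
        rw [Real.norm_eq_abs, h2, abs_le]; constructor <;> linarith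
    _ = _ := by
        rw [ENNReal.ofReal_mul ENNReal.toReal_nonneg, ENNReal.ofReal_toReal hMt, ofReal_two_zpow]

lemma FF_zero {d : ℕ} (v : Pt d → ℝ) (z : Pt d) : FF d v z 0 = v z := by
  have : ∀ w, dl d z 0 w = z := fun w => by simp [dl]
  simp [FF, this, integral_const_mul, ph_int]

lemma FF_large {d : ℕ} {v : Pt d → ℝ} (hv : ContDiff ℝ (⊤ : ℕ∞) v) (hc : HasCompactSupport v)
    (z : Pt d) : Tendsto (fun n : ℕ => FF d v z (2 ^ (n : ℤ))) atTop (nhds 0) := by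
  obtain ⟨C2, hC2⟩ := (ph_cs d).exists_bound_of_continuous (ph_cd d).continuous
  have h20 : 0 ≤ C2 := (norm_nonneg _).trans (hC2 0)
  have hvi : Integrable v := hv.continuous.integrable_of_hasCompactSupport hc
  have hbd : ∀ n : ℕ, ‖FF d v z (2 ^ (n : ℤ))‖ₑ ≤
      ENNReal.ofReal (C2 * (((2:ℝ)⁻¹ ^ (d + 2)) ^ n)) * ∫⁻ w, ‖v w‖ₑ := by
    intro n
    refine (enorm_integral_le_lintegral_enorm _).trans ?_
    have hm : Measurable (fun w => ‖v w‖ₑ) := hv.continuous.measurable.enorm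
    have hm' : Measurable (fun w => ‖v (dl d z (2 ^ (n:ℤ)) w)‖ₑ) := hm.comp (dl_cont d z _).measurable
    calc _ ≤ ∫⁻ w, ENNReal.ofReal C2 * ‖v (dl d z (2 ^ (n:ℤ)) w)‖ₑ := by
          refine lintegral_mono fun w => ?_
          rw [enorm_mul, mul_comm, ← ofReal_norm (ph d w)]
          gcongr
          exact hC2 w
      _ = _ := by
          rw [lintegral_const_mul _ hm', lint_dl d z (2 ^ (n:ℤ)) (by positivity) hm, ← mul_assoc,
            ← ENNReal.ofReal_mul h20]
          congr 3
          rw [zpow_natCast, ← pow_mul, ← pow_mul, inv_pow, mul_comm]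
  rw [tendsto_zero_iff_enorm_tendsto_zero]
  refine tendsto_of_tendsto_of_tendsto_of_le_of_le tendsto_const_nhds ?_ (fun _ => zero_le) hbd
  have h1 : Tendsto (fun n : ℕ => C2 * (((2:ℝ)⁻¹ ^ (d + 2)) ^ n)) atTop (nhds (C2 * 0)) := by
    refine Tendsto.const_mul _ (tendsto_pow_atTop_nhds_zero_of_lt_one (by positivity) ?_)
    exact pow_lt_one₀ (by norm_num) (by norm_num) (by omega)
  have h2 := ENNReal.Tendsto.mul_const (b := ∫⁻ w, ‖v w‖ₑ) ((ENNReal.continuous_ofReal.tendsto _).comp h1)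
    (Or.inr hvi.hasFiniteIntegral.ne)
  simpa using h2

lemma spDeriv_le_T (d : ℕ) (i : Fin d) : ∃ C : ℝ≥0∞, C ≠ ⊤ ∧ ∀ u : Pt d → ℝ, ContDiff ℝ (⊤ : ℕ∞) u →
    HasCompactSupport u → ∀ z, ‖spDeriv d i u z‖ₑ ≤ C * (PS d).T (f0 d u) z := by
  obtain ⟨C, hC, hb⟩ := deriv_bound d i
  refine ⟨ENNReal.ofReal C * ((PS d).D * Vb d 0), ENNReal.mul_ne_top ENNReal.ofReal_ne_top
    (ENNReal.mul_ne_top (PS d).D_top ((PS d).V_top 0)), ?_⟩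
  intro u hu hc z
  have hv := spDeriv_cd hu i
  have hvc := spDeriv_cs hc i
  set G := FF d (spDeriv d i u) z with hG
  set K := ENNReal.ofReal C * ((PS d).D * Vb d 0) with hK
  have hstep : ∀ k : ℤ, edist (G (2 ^ k)) (G (2 ^ (k + 1))) ≤
      K * (2 ^ (k + 1) * (PS d).A (f0 d u) (k + 1) z) := by
    intro k
    have := FF_step hv hvc z k (K * (PS d).A (f0 d u) (k + 1) z) (fun r h1 h2 => by
      refine (hb u hu hc z r).trans ?_
      rw [hK, mul_assoc]
      gcongr
      exact lint_dl_ball d z k r h1 h2 (f0_meas hu))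
    refine this.trans (le_of_eq ?_)
    ring
  have hfin : ∀ n : ℕ, edist (G (2 ^ (-(n:ℤ)))) (G (2 ^ (n:ℤ))) ≤ K * (PS d).T (f0 d u) z := by
    intro n
    have h1 := edist_le_range_sum_edist (fun m : ℕ => G (2 ^ ((m:ℤ) - n))) (2 * n)
    have e1 : ((0:ℕ):ℤ) - n = -n := by simp
    have e2 : ((2 * n : ℕ):ℤ) - n = n := by push_cast; ring
    simp only [e1, e2] at h1
    refine h1.trans ?_
    calc _ ≤ ∑ m ∈ Finset.range (2 * n), K * (2 ^ ((m:ℤ) - n + 1) *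
            (PS d).A (f0 d u) ((m:ℤ) - n + 1) z) := by
          refine Finset.sum_le_sum fun m _ => ?_
          have := hstep ((m:ℤ) - n)
          have e3 : ((m + 1 : ℕ):ℤ) - n = (m:ℤ) - n + 1 := by push_cast; ring
          rw [e3]
          exact this
      _ = K * ∑ m ∈ Finset.range (2 * n), (2 ^ ((m:ℤ) - n + 1) *
            (PS d).A (f0 d u) ((m:ℤ) - n + 1) z) := by rw [Finset.mul_sum]
      _ ≤ K * (PS d).T (f0 d u) z := by
          gcongr
          refine (ENNReal.sum_le_tsum _).trans ?_
          exact ENNReal.tsum_comp_le_tsum_of_injective (f := fun m : ℕ => (m:ℤ) - n + 1)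
            (fun a b h => by simpa using h) (fun k : ℤ => (2:ℝ≥0∞) ^ k * (PS d).A (f0 d u) k z)
  have hGc : Continuous G := continuous_iff_continuousAt.2 fun r =>
    (hasDeriv_FF hv hvc z r).continuousAt
  have t1 : Tendsto (fun n : ℕ => G (2 ^ (-(n:ℤ)))) atTop (nhds (spDeriv d i u z)) := by
    rw [← FF_zero (spDeriv d i u) z]
    refine (hGc.tendsto 0).comp ?_
    have := tendsto_pow_atTop_nhds_zero_of_lt_one (r := (2:ℝ)⁻¹) (by norm_num) (by norm_num)
    simpa using this
  have t2 := FF_large hv hvc z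
  have t3 := t1.edist t2
  rw [edist_zero_right] at t3
  exact le_of_tendsto' t3 hfin

lemma LpNormE_pow (d : ℕ) (p : ℝ) (hp : 0 < p) (f : Pt d → ℝ≥0∞) :
    LpNormE d p f ^ p = ∫⁻ z : Pt d, f z ^ p := by
  rw [LpNormE, ← ENNReal.rpow_mul, one_div, inv_mul_cancel₀ hp.ne', ENNReal.rpow_one]

lemma gradNorm_le_T (d : ℕ) : ∃ C : ℝ≥0∞, C ≠ ⊤ ∧ ∀ u : Pt d → ℝ, ContDiff ℝ (⊤ : ℕ∞) u →
    HasCompactSupport u → ∀ z, ENNReal.ofReal (gradNorm d u z) ≤ C * (PS d).T (f0 d u) z := by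
  choose C hC hb using spDeriv_le_T d
  refine ⟨∑ i, C i, ENNReal.sum_ne_top.2 fun i _ => hC i, ?_⟩
  intro u hu hc z
  have h1 : gradNorm d u z ≤ ∑ i, ‖spDeriv d i u z‖ := by
    refine Real.sqrt_le_iff.2 ⟨Finset.sum_nonneg fun _ _ => norm_nonneg _, ?_⟩
    calc _ = ∑ i, ‖spDeriv d i u z‖ ^ 2 := by simp
      _ ≤ _ := Finset.sum_sq_le_sq_sum_of_nonneg fun _ _ => norm_nonneg _
  refine (ENNReal.ofReal_le_ofReal h1).trans ?_
  rw [ENNReal.ofReal_sum_of_nonneg fun _ _ => norm_nonneg _, Finset.sum_mul]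
  refine Finset.sum_le_sum fun i _ => ?_
  rw [ofReal_norm]
  exact hb i u hu hc z

/-- Theorem 4.1, (4.2): for `d+2 ≥ q > p > 1` there is `N = N(d,p,q)` such
that `∫ |b|^p |Du|^p dz ≤ N ‖|b|‖_{E_{q,1}}^p (‖∂_t u‖_{L_p}^p + ‖|D²u|‖_{L_p}^p)`. -/
theorem stmt13 (d : ℕ) (hd : 1 ≤ d) (p q : ℝ) (hp : 1 < p) (hpq : p < q)
    (hq : q ≤ (d : ℝ) + 2) :
    ∃ N : ℝ, 0 < N ∧ ∀ b : Pt d → Ed d, Measurable b →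
      MorreyNorm d q 1 univ (fun z => ENNReal.ofReal ‖b z‖) ≠ ⊤ →
      ∀ u : Pt d → ℝ, ContDiff ℝ (⊤ : ℕ∞) u → HasCompactSupport u →
        ∫⁻ z : Pt d, ENNReal.ofReal ‖b z‖ ^ p * ENNReal.ofReal (gradNorm d u z) ^ p ≤
          ENNReal.ofReal N * MorreyNorm d q 1 univ (fun z => ENNReal.ofReal ‖b z‖) ^ p *
            (LpNormE d p (fun z => ENNReal.ofReal |timeDeriv d u z|) ^ p +
              LpNormE d p (fun z => ENNReal.ofReal (hessNorm d u z)) ^ p) := by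
  obtain ⟨C, hC, hg⟩ := gradNorm_le_T d
  have hp0 : 0 < p := by linarith
  have hq0 : 0 < q := by linarith
  set N0 : ℝ≥0∞ := C ^ p * ((PS d).MC p q * (((PS d).D ^ (1 / q)) ^ p * 2 ^ (p - 1))) with hN0
  have hDt : (PS d).D ^ (1 / q) ≠ ⊤ := ENNReal.rpow_ne_top_of_nonneg (by positivity) (PS d).D_top
  have hN0t : N0 ≠ ⊤ := by
    refine ENNReal.mul_ne_top (ENNReal.rpow_ne_top_of_nonneg hp0.le hC)
      (ENNReal.mul_ne_top ((PS d).MC_top hp hpq) (ENNReal.mul_ne_top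
        (ENNReal.rpow_ne_top_of_nonneg hp0.le hDt)
        (ENNReal.rpow_ne_top_of_nonneg (by linarith) (by simp))))
  refine ⟨N0.toReal + 1, by positivity, ?_⟩
  intro b hb hBt u hu hc
  have hN : N0 ≤ ENNReal.ofReal (N0.toReal + 1) := by
    calc N0 = ENNReal.ofReal N0.toReal := (ENNReal.ofReal_toReal hN0t).symm
      _ ≤ _ := ENNReal.ofReal_le_ofReal (by linarith)
  set b' : Pt d → ℝ≥0∞ := fun z => ENNReal.ofReal ‖b z‖ with hb'
  have hbm : Measurable b' := by fun_prop
  set Mo := MorreyNorm d q 1 univ b' with hMo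
  have hmain := (PS d).main hp hpq hbm (B := (PS d).D ^ (1 / q) * Mo)
    (ENNReal.mul_ne_top hDt hBt) (morrey_A d q hq0 b') (f0_meas hu)
  rw [LpNormE_pow d p hp0, LpNormE_pow d p hp0]
  have ht : Measurable (fun z => ENNReal.ofReal |timeDeriv d u z| ^ p) := by
    have := (timeDeriv_cd hu).continuous.measurable
    fun_prop
  calc ∫⁻ z : Pt d, b' z ^ p * ENNReal.ofReal (gradNorm d u z) ^ p
      ≤ ∫⁻ z : Pt d, C ^ p * (b' z ^ p * (PS d).T (f0 d u) z ^ p) := by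
        refine lintegral_mono fun z => ?_
        calc _ ≤ b' z ^ p * (C * (PS d).T (f0 d u) z) ^ p := by
              gcongr
              exact hg u hu hc z
          _ = _ := by rw [ENNReal.mul_rpow_of_nonneg _ _ hp0.le]; ring
    _ = C ^ p * ∫⁻ z : Pt d, b' z ^ p * (PS d).T (f0 d u) z ^ p :=
        lintegral_const_mul' _ _ (ENNReal.rpow_ne_top_of_nonneg hp0.le hC)
    _ ≤ C ^ p * ((PS d).MC p q * ((PS d).D ^ (1 / q) * Mo) ^ p * ∫⁻ z, f0 d u z ^ p) := by
        gcongr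
    _ ≤ C ^ p * ((PS d).MC p q * ((PS d).D ^ (1 / q) * Mo) ^ p *
          (2 ^ (p - 1) * ((∫⁻ z, ENNReal.ofReal |timeDeriv d u z| ^ p) +
            ∫⁻ z, ENNReal.ofReal (hessNorm d u z) ^ p))) := by
        gcongr
        rw [← lintegral_add_left ht, ← lintegral_const_mul' _ _
          (ENNReal.rpow_ne_top_of_nonneg (by linarith) (by simp))]
        refine lintegral_mono fun z => ?_
        exact ENNReal.rpow_add_le_mul_rpow_add_rpow _ _ hp.le
    _ = N0 * Mo ^ p * ((∫⁻ z, ENNReal.ofReal |timeDeriv d u z| ^ p) +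
            ∫⁻ z, ENNReal.ofReal (hessNorm d u z) ^ p) := by
        rw [hN0, ENNReal.mul_rpow_of_nonneg _ _ hp0.le]; ring
    _ ≤ _ := by gcongr

end
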